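/- arXiv:2308.02232 — 3 statements merged into one kernel-verified Lean document; each statement's English description precedes it below -/
import Mathlib

section
/- Let p be a prime, m ≥ 0 and n ≥ 1 integers, and let μ be the Haar probability measure on the compact additive group Mat_{n×(n+m)}(ℤ_p) of n×(n+m) matrices over the p-adic integers. For every finite abelian p-group G, setting r := dim_{F_p}(G/pG), w_m(G) := (η_∞(p)/η_m(p))/(|G|^m · |Aut(G)|) and λ_m(G) := w_m(G)·(1 + p^{−m} − p^{r})/(p−1), one has |μ({M : coker M ≅ G}) − w_m(G) − λ_m(G)·p^{−n}| ≤ (η_m(p)²/η_∞(p)² − 1)^{1/2} · p^{−2n}. -/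
noncomputable section

open MeasureTheory

/-- `η_k(q) = ∏_{i=1}^{k} (1 - q^{-i})`. -/
def etaF (q : ℝ) (k : ℕ) : ℝ := ∏ i ∈ Finset.range k, (1 - q⁻¹ ^ (i + 1))

/-- `η_∞(q) = ∏_{i=1}^{∞} (1 - q^{-i})`. -/
def etaInf (q : ℝ) : ℝ := ∏' i : ℕ, (1 - q⁻¹ ^ (i + 1))

instance matMeasurableSpace (p a b : ℕ) [Fact p.Prime] :
    MeasurableSpace (Matrix (Fin a) (Fin b) ℤ_[p]) := borel _

instance matBorelSpace (p a b : ℕ) [Fact p.Prime] :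
    BorelSpace (Matrix (Fin a) (Fin b) ℤ_[p]) := ⟨rfl⟩

open Module in
/-- The number of spanning `k`-tuples in a finite vector space. -/
theorem card_span_eq_top_field {F W : Type*} [Field F] [Finite F] [AddCommGroup W] [Module F W]
    [Finite W] (k : ℕ) :
    (Nat.card {t : Fin k → W // Submodule.span F (Set.range t) = ⊤} : ℝ) =
      ∏ i ∈ Finset.range (finrank F W), ((Nat.card F : ℝ) ^ k - (Nat.card F : ℝ) ^ i) := by
  classical
  have := Fintype.ofFinite F
  set d := finrank F W with hd
  let e : W ≃ₗ[F] (Fin d → F) := (finBasis F W).equivFun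
  have hiff (t : Fin k → W) : Submodule.span F (Set.range t) = ⊤ ↔
      LinearIndependent F (fun (i : Fin d) (j : Fin k) ↦ e (t j) i) := by
    let A : Matrix (Fin d) (Fin k) F := fun i j ↦ e (t j) i
    change _ ↔ LinearIndependent F A.row
    rw [linearIndependent_iff_card_eq_finrank_span, Set.finrank, ← A.rank_eq_finrank_span_row,
      A.rank_eq_finrank_span_cols]
    have h1 : Set.range A.col = e '' Set.range t := by
      rw [← Set.range_comp]; rfl
    have h2 : Submodule.span F (e '' Set.range t) =
        (Submodule.span F (Set.range t)).map (e : W →ₗ[F] (Fin d → F)) := by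
      rw [Submodule.map_span]; rfl
    rw [h1, h2, LinearEquiv.finrank_map_eq, Fintype.card_fin]
    constructor
    · intro h; rw [h, finrank_top]
    · intro h; exact Submodule.eq_top_of_finrank_eq h.symm
  have hcard : Nat.card {t : Fin k → W // Submodule.span F (Set.range t) = ⊤} =
      Nat.card {s : Fin d → (Fin k → F) // LinearIndependent F s} := by
    refine Nat.card_congr (Equiv.subtypeEquiv
      ((Equiv.piCongrRight fun _ ↦ e.toEquiv).trans (Equiv.piComm _)) fun t ↦ ?_)
    exact hiff t
  rw [hcard]
  by_cases hdk : d ≤ k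
  · rw [card_linearIndependent (by simpa using hdk), finrank_fin_fun, ← Nat.card_eq_fintype_card,
      Nat.cast_prod, Finset.prod_range]
    refine Finset.prod_congr rfl fun i _ ↦ ?_
    rw [Nat.cast_sub (Nat.pow_le_pow_right Nat.card_pos (by omega))]
    push_cast; rfl
  · rw [Finset.prod_eq_zero (i := k) (Finset.mem_range.2 (by omega)) (sub_self _)]
    have : IsEmpty {s : Fin d → (Fin k → F) // LinearIndependent F s} :=
      ⟨fun s ↦ hdk (by simpa using s.2.fintype_card_le_finrank)⟩
    simp

/-- The number of preimages of a set under a surjective homomorphism of finite groups. -/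
theorem card_preimage_mul_card {X Y : Type*} [AddGroup X] [AddGroup Y] [Finite X]
    (f : X →+ Y) (hf : Function.Surjective f) (T : Set Y) :
    Nat.card (f ⁻¹' T) * Nat.card Y = Nat.card T * Nat.card X := by
  have : Finite Y := Finite.of_surjective f hf
  have hfib (y : Y) : Nat.card {x : X // f x = y} = Nat.card f.ker := by
    obtain ⟨x₀, rfl⟩ := hf y
    refine Nat.card_congr (Equiv.subtypeEquiv (Equiv.addRight (-x₀)) fun x ↦ ?_)
    simp [AddMonoidHom.mem_ker, add_neg_eq_zero]
  have h (S : Set Y) : Nat.card (f ⁻¹' S) = Nat.card S * Nat.card f.ker := by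
    have := Fintype.ofFinite S
    rw [Nat.card_congr (Equiv.sigmaFiberEquiv (fun x : f ⁻¹' S ↦ (⟨f x, x.2⟩ : S))).symm,
      Nat.card_sigma]
    rw [Finset.sum_congr rfl (fun y _ ↦ ?_), Finset.sum_const, Finset.card_univ, smul_eq_mul,
      Nat.card_eq_fintype_card]
    rw [← hfib y]
    exact Nat.card_congr
      ⟨fun x ↦ ⟨x.1, congrArg Subtype.val x.2⟩,
        fun x ↦ ⟨⟨x.1, by rw [Set.mem_preimage, x.2]; exact y.2⟩, Subtype.ext x.2⟩,
        fun _ ↦ rfl, fun _ ↦ rfl⟩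
  have h1 := h Set.univ
  rw [Set.preimage_univ, Nat.card_univ, Nat.card_univ] at h1
  rw [h, h1]; ring

section Padic
variable {p : ℕ} [Fact p.Prime]

open scoped Pointwise

/-- The number of spanning `k`-tuples in an elementary abelian `p`-group. -/
theorem card_span_eq_top_of_smul_eq_zero {W : Type*} [AddCommGroup W] [Module ℤ_[p] W]
    (hW : ∀ w : W, (p : ℤ_[p]) • w = 0) {d : ℕ} (hd : Nat.card W = p ^ d) (k : ℕ) :
    (Nat.card {t : Fin k → W // Submodule.span ℤ_[p] (Set.range t) = ⊤} : ℝ) =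
      ∏ i ∈ Finset.range d, ((p : ℝ) ^ k - (p : ℝ) ^ i) := by
  have hp : p.Prime := Fact.out
  have : Finite W := Nat.finite_of_card_ne_zero (by rw [hd]; exact pow_ne_zero _ hp.ne_zero)
  let I := IsLocalRing.maximalIdeal ℤ_[p]
  have htors : Module.IsTorsionBySet ℤ_[p] W I := by
    rintro x ⟨a, ha⟩
    change a • x = 0
    change a ∈ IsLocalRing.maximalIdeal ℤ_[p] at ha
    rw [PadicInt.maximalIdeal_eq_span_p] at ha
    obtain ⟨b, rfl⟩ := Ideal.mem_span_singleton'.1 ha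
    rw [mul_smul, hW, smul_zero]
  let _ : Module (ℤ_[p] ⧸ I) W := htors.module
  have : IsScalarTower ℤ_[p] (ℤ_[p] ⧸ I) W := htors.isScalarTower
  let _ : Field (ℤ_[p] ⧸ I) := Ideal.Quotient.field I
  have hF : Nat.card (ℤ_[p] ⧸ I) = p := by
    have := Nat.card_congr (PadicInt.residueField (p := p)).toEquiv
    rwa [Nat.card_zmod] at this
  have : Finite (ℤ_[p] ⧸ I) := Nat.finite_of_card_ne_zero (by rw [hF]; exact hp.ne_zero)
  have hfr : Module.finrank (ℤ_[p] ⧸ I) W = d := by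
    have := Module.natCard_eq_pow_finrank (K := ℤ_[p] ⧸ I) (V := W)
    rw [hF, hd] at this
    exact (Nat.pow_right_injective hp.two_le this).symm
  have key := card_span_eq_top_field (F := ℤ_[p] ⧸ I) (W := W) k
  rw [hfr, hF] at key
  rw [← key]
  congr 1
  refine Nat.card_congr (Equiv.subtypeEquivRight fun t ↦ ?_)
  rw [← Submodule.restrictScalars_span ℤ_[p] (ℤ_[p] ⧸ I) Ideal.Quotient.mk_surjective,
    Submodule.restrictScalars_eq_top_iff]

/-- Nakayama's lemma for the ideal `p ℤ_p`. -/
theorem eq_of_sup_smul_eq {M : Type*} [AddCommGroup M] [Module ℤ_[p] M] {N L : Submodule ℤ_[p] M}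
    (hL : L.FG) (h : N ⊔ (p : ℤ_[p]) • L = L) : N = L := by
  refine le_antisymm (h ▸ le_sup_left) ?_
  refine Submodule.le_of_le_smul_of_le_jacobson_bot (I := IsLocalRing.maximalIdeal ℤ_[p]) hL
    (IsLocalRing.maximalIdeal_le_jacobson _) ?_
  rw [PadicInt.maximalIdeal_eq_span_p, Submodule.ideal_span_singleton_smul, h]

theorem map_mkQ_smul_eq_iff {M : Type*} [AddCommGroup M] [Module ℤ_[p] M]
    {N L : Submodule ℤ_[p] M} (hL : L.FG) :
    N.map ((p : ℤ_[p]) • L).mkQ = L.map ((p : ℤ_[p]) • L).mkQ ↔ N = L := by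
  refine ⟨fun h ↦ ?_, fun h ↦ h ▸ rfl⟩
  have h2 := congrArg (Submodule.comap ((p : ℤ_[p]) • L).mkQ) h
  have hle : (p : ℤ_[p]) • L ≤ L := Submodule.smul_le_self_of_tower _ _
  rw [Submodule.comap_map_mkQ, Submodule.comap_map_mkQ, sup_eq_right.2 hle, sup_comm] at h2
  exact eq_of_sup_smul_eq hL h2

/-- The number of spanning `k`-tuples in a finite `p`-group of rank `d`. -/
theorem card_span_eq_top {W : Type*} [AddCommGroup W] [Module ℤ_[p] W] [Finite W] {d : ℕ}
    (hd : Nat.card (W ⧸ (p : ℤ_[p]) • (⊤ : Submodule ℤ_[p] W)) = p ^ d) (k : ℕ) :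
    (Nat.card {t : Fin k → W // Submodule.span ℤ_[p] (Set.range t) = ⊤} : ℝ) * ((p : ℝ) ^ d) ^ k =
      (Nat.card W : ℝ) ^ k * ∏ i ∈ Finset.range d, ((p : ℝ) ^ k - (p : ℝ) ^ i) := by
  set P := (p : ℤ_[p]) • (⊤ : Submodule ℤ_[p] W) with hP
  have h1 := card_span_eq_top_of_smul_eq_zero (W := W ⧸ P) (fun w ↦ by
    obtain ⟨w, rfl⟩ := P.mkQ_surjective w
    rw [← map_smul, Submodule.mkQ_apply, Submodule.Quotient.mk_eq_zero]
    exact Submodule.smul_mem_pointwise_smul _ _ _ trivial) hd k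
  let f : (Fin k → W) →+ (Fin k → W ⧸ P) := P.mkQ.toAddMonoidHom.compLeft (Fin k)
  have hf : Function.Surjective f := P.mkQ_surjective.comp_left
  have h2 := card_preimage_mul_card f hf {t | Submodule.span ℤ_[p] (Set.range t) = ⊤}
  have h3 : f ⁻¹' {t | Submodule.span ℤ_[p] (Set.range t) = ⊤} =
      {t : Fin k → W | Submodule.span ℤ_[p] (Set.range t) = ⊤} := by
    ext t
    have hr : Set.range (f t) = P.mkQ '' Set.range t := Set.range_comp P.mkQ t
    rw [Set.mem_preimage, Set.mem_ofPred_eq, Set.mem_ofPred_eq, hr, ← Submodule.map_span,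
      ← map_mkQ_smul_eq_iff (p := p) (N := Submodule.span ℤ_[p] (Set.range t))
        (Module.Finite.fg_top (R := ℤ_[p]) (M := W)), Submodule.map_top, Submodule.range_mkQ]
  rw [h3, Nat.card_fun, Nat.card_fun, hd, Nat.card_fin] at h2
  rw [← h1, mul_comm ((Nat.card W : ℝ) ^ k)]
  exact_mod_cast h2

end Padic

/-- The uniform distribution of the image of Haar measure in a finite quotient. -/
theorem measureReal_preimage_eq {X K : Type*} [AddGroup X] [TopologicalSpace X]
    [IsTopologicalAddGroup X] [MeasurableSpace X] [BorelSpace X] (μ : Measure X)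
    [μ.IsAddLeftInvariant] [IsProbabilityMeasure μ] [AddGroup K] [Finite K] (f : X →+ K)
    (hf : Function.Surjective f) (hker : IsOpen (f.ker : Set X)) (T : Set K) :
    MeasurableSet (f ⁻¹' T) ∧ μ.real (f ⁻¹' T) = Nat.card T / Nat.card K := by
  classical
  have := Fintype.ofFinite K
  have htr (x : X) : f ⁻¹' {f x} = (fun y ↦ -x + y) ⁻¹' (f.ker : Set X) := by
    ext y
    simp [AddMonoidHom.mem_ker, neg_add_eq_zero, eq_comm (a := f y)]
  have hmeas (k : K) : MeasurableSet (f ⁻¹' {k}) := by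
    obtain ⟨x, rfl⟩ := hf k
    rw [htr]
    exact (hker.preimage (continuous_const_add (-x))).measurableSet
  have hconst (k : K) : μ.real (f ⁻¹' {k}) = μ.real (f.ker : Set X) := by
    obtain ⟨x, rfl⟩ := hf k
    rw [htr, measureReal_def, measure_preimage_add, measureReal_def]
  have hU (S : Set K) : f ⁻¹' S = ⋃ k ∈ S.toFinset, f ⁻¹' {k} := by
    ext y; simp
  have hsum (S : Set K) : μ.real (f ⁻¹' S) = Nat.card S * μ.real (f.ker : Set X) := by
    rw [hU, measureReal_biUnion_finset _ fun k _ ↦ hmeas k, Finset.sum_congr rfl fun k _ ↦ hconst k,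
      Finset.sum_const, nsmul_eq_mul, Set.toFinset_card, Nat.card_eq_fintype_card]
    intro a _ b _ hab
    exact Disjoint.preimage f (by simpa using hab)
  refine ⟨?_, ?_⟩
  · rw [hU]
    exact Finset.measurableSet_biUnion _ fun k _ ↦ hmeas k
  · have h1 := hsum Set.univ
    rw [Set.preimage_univ, probReal_univ, Nat.card_univ] at h1
    have : (Nat.card K : ℝ) ≠ 0 := fun h ↦ by rw [h, zero_mul] at h1; exact one_ne_zero h1
    rw [hsum, eq_div_iff this]
    linear_combination (-(Nat.card T : ℝ)) * h1

section Padic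
variable {p : ℕ} [Fact p.Prime]
open scoped Pointwise

/-- Additive maps into modules of bounded exponent are `ℤ_p`-linear. -/
def AddMonoidHom.toPadicLinearMap {X Y : Type*} [AddCommGroup X] [Module ℤ_[p] X] [AddCommGroup Y]
    [Module ℤ_[p] Y] {e : ℕ} (hY : ∀ y : Y, p ^ e • y = 0) (f : X →+ Y) : X →ₗ[ℤ_[p]] Y where
  toFun := f
  map_add' := map_add f
  map_smul' a x := by
    obtain ⟨b, hb⟩ := Ideal.mem_span_singleton'.1 (PadicInt.appr_spec e a)
    have ha : a = (p ^ e : ℕ) * b + (a.appr e : ℕ) := by push_cast; linear_combination -hb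
    have h1 : f (a • x) = a.appr e • f x := by
      rw [ha, add_smul, mul_smul, map_add, Nat.cast_smul_eq_nsmul, Nat.cast_smul_eq_nsmul,
        map_nsmul, map_nsmul, hY, zero_add, ← ha]
    have h2 : a • f x = a.appr e • f x := by
      rw [ha, add_smul, mul_smul, Nat.cast_smul_eq_nsmul, Nat.cast_smul_eq_nsmul, hY, zero_add,
        ← ha]
    rw [h1, RingHom.id_apply, h2]

/-- The additive isomorphisms to a module of bounded exponent are linear. -/
theorem exists_linearEquiv_of_addEquiv {X Y : Type*} [AddCommGroup X] [Module ℤ_[p] X]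
    [AddCommGroup Y] [Module ℤ_[p] Y] {e : ℕ} (hY : ∀ y : Y, p ^ e • y = 0) (f : X ≃+ Y) :
    ∃ g : X ≃ₗ[ℤ_[p]] Y, ∀ x, g x = f x :=
  ⟨LinearEquiv.ofBijective (f.toAddMonoidHom.toPadicLinearMap hY) f.bijective, fun _ ↦ rfl⟩

/-- A surjection onto `G` is given by its kernel and an automorphism of `G`. -/
theorem nonempty_quotient_prod_aut_equiv {G : Type*} [AddCommGroup G] [Module ℤ_[p] G] {e : ℕ}
    (hG : ∀ g : G, p ^ e • g = 0) (n : ℕ) :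
    Nonempty
      ({L : Submodule ℤ_[p] (Fin n → ℤ_[p]) // Nonempty (((Fin n → ℤ_[p]) ⧸ L) ≃+ G)} ×
        (G ≃+ G) ≃ {t : Fin n → G // Submodule.span ℤ_[p] (Set.range t) = ⊤}) := by
  let V := Fin n → ℤ_[p]
  let B := (Pi.basisFun ℤ_[p] (Fin n)).constr ℤ_[p] (M' := G)
  have hB : {t : Fin n → G // Submodule.span ℤ_[p] (Set.range t) = ⊤} ≃
      {φ : V →ₗ[ℤ_[p]] G // Function.Surjective φ} := by
    refine Equiv.subtypeEquiv B.toEquiv fun t ↦ ?_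
    change _ ↔ Function.Surjective (B t)
    rw [← LinearMap.range_eq_top, Module.Basis.constr_range]
  have hiso (L : {L : Submodule ℤ_[p] V // Nonempty ((V ⧸ L) ≃+ G)}) :
      Nonempty ((V ⧸ L.1) ≃ₗ[ℤ_[p]] G) :=
    let ⟨g, _⟩ := exists_linearEquiv_of_addEquiv hG L.2.some
    ⟨g⟩
  have iso L := (hiso L).some
  let F (x : {L : Submodule ℤ_[p] V // Nonempty ((V ⧸ L) ≃+ G)} × (G ≃+ G)) :
      {φ : V →ₗ[ℤ_[p]] G // Function.Surjective φ} :=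
    ⟨x.2.toAddMonoidHom.toPadicLinearMap hG ∘ₗ (iso x.1).toLinearMap ∘ₗ x.1.1.mkQ,
      x.2.surjective.comp ((iso x.1).surjective.comp x.1.1.mkQ_surjective)⟩
  have hFapp x v : (F x).1 v = x.2 (iso x.1 (x.1.1.mkQ v)) := rfl
  have hker x : LinearMap.ker (F x).1 = x.1.1 := by
    ext v
    rw [LinearMap.mem_ker, hFapp, map_eq_zero_iff x.2 x.2.injective,
      map_eq_zero_iff (iso x.1) (iso x.1).injective, Submodule.mkQ_apply,
      Submodule.Quotient.mk_eq_zero]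
  refine ⟨(Equiv.ofBijective F ⟨?_, ?_⟩).trans hB.symm⟩
  · rintro ⟨L, σ⟩ ⟨L', σ'⟩ h
    obtain rfl : L = L' := Subtype.ext (by rw [← hker (L, σ), h, hker])
    refine Prod.ext rfl (AddEquiv.ext fun g ↦ ?_)
    obtain ⟨v, rfl⟩ := (iso L).surjective.comp L.1.mkQ_surjective g
    have := congrArg (fun φ ↦ φ.1 v) h
    exact this
  · rintro ⟨φ, hφ⟩
    let q := φ.quotKerEquivOfSurjective hφ
    let L : {L : Submodule ℤ_[p] V // Nonempty ((V ⧸ L) ≃+ G)} :=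
      ⟨LinearMap.ker φ, ⟨q.toAddEquiv⟩⟩
    refine ⟨(L, (iso L).symm.toAddEquiv.trans q.toAddEquiv), Subtype.ext (LinearMap.ext fun v ↦ ?_)⟩
    rw [hFapp]
    change q ((iso L).symm (iso L ((LinearMap.ker φ).mkQ v))) = φ v
    rw [LinearEquiv.symm_apply_apply]
    rfl

theorem card_quotient_smul (n : ℕ) (L : Submodule ℤ_[p] (Fin n → ℤ_[p])) :
    Nat.card ((Fin n → ℤ_[p]) ⧸ (p : ℤ_[p]) • L) = Nat.card ((Fin n → ℤ_[p]) ⧸ L) * p ^ n := by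
  let V := Fin n → ℤ_[p]
  let f : V →+ V := DistribSMul.toAddMonoidHom V (p : ℤ_[p])
  have hp : (p : ℤ_[p]) ≠ 0 := Nat.cast_ne_zero.2 (Fact.out : p.Prime).ne_zero
  have hf : Function.Injective f := fun a b h ↦ smul_right_injective V hp h
  have h1 := L.toAddSubgroup.index_map_of_injective hf
  have h2 : f.range.index = p ^ n := by
    let g : V →+ (Fin n → ZMod p) := (PadicInt.toZMod (p := p)).toAddMonoidHom.compLeft (Fin n)
    have hg : Function.Surjective g :=
      (ZMod.ringHom_surjective (PadicInt.toZMod (p := p))).comp_left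
    have hk : f.range = g.ker := by
      ext v
      have hz (a : ℤ_[p]) : PadicInt.toZMod a = 0 ↔ ∃ b, b * (p : ℤ_[p]) = a := by
        rw [← RingHom.mem_ker, PadicInt.ker_toZMod, PadicInt.maximalIdeal_eq_span_p,
          Ideal.mem_span_singleton']
      have : v ∈ g.ker ↔ ∀ i, PadicInt.toZMod (v i) = 0 := by
        rw [AddMonoidHom.mem_ker, funext_iff]; rfl
      rw [this]
      simp only [hz]
      constructor
      · rintro ⟨w, rfl⟩ i
        exact ⟨w i, mul_comm _ _⟩
      · intro h
        choose w hw using h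
        exact ⟨w, funext fun i ↦ (mul_comm _ _).trans (hw i)⟩
    rw [hk, AddSubgroup.index_ker, AddMonoidHom.range_eq_top.2 hg, AddSubgroup.card_top,
      Nat.card_fun, Nat.card_zmod, Nat.card_fin]
  rw [h2] at h1
  exact h1

theorem card_map_mkQ_smul (n : ℕ) (L : Submodule ℤ_[p] (Fin n → ℤ_[p]))
    [Finite ((Fin n → ℤ_[p]) ⧸ L)] :
    Nat.card (L.map ((p : ℤ_[p]) • L).mkQ) = p ^ n := by
  have hle : (p : ℤ_[p]) • L ≤ L := Submodule.smul_le_self_of_tower _ _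
  have h1 := Submodule.card_eq_card_quotient_mul_card (L.map ((p : ℤ_[p]) • L).mkQ)
  have h2 := Nat.card_congr (Submodule.quotientQuotientEquivQuotient _ _ hle).toEquiv
  rw [h2, card_quotient_smul] at h1
  have : 0 < Nat.card ((Fin n → ℤ_[p]) ⧸ L) := Nat.card_pos
  exact (Nat.eq_of_mul_eq_mul_left this (h1.trans (mul_comm _ _))).symm

theorem card_span_eq_map_mkQ (n N : ℕ) (L : Submodule ℤ_[p] (Fin n → ℤ_[p]))
    [Finite ((Fin n → ℤ_[p]) ⧸ L)] :
    (Nat.card {t : Fin N → (Fin n → ℤ_[p]) ⧸ (p : ℤ_[p]) • L //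
      Submodule.span ℤ_[p] (Set.range t) = L.map ((p : ℤ_[p]) • L).mkQ} : ℝ) =
      ∏ i ∈ Finset.range n, ((p : ℝ) ^ N - (p : ℝ) ^ i) := by
  set S := L.map ((p : ℤ_[p]) • L).mkQ with hS
  have h0 : ∀ w : S, (p : ℤ_[p]) • w = 0 := by
    rintro ⟨_, v, hv, rfl⟩
    refine Subtype.ext ?_
    change (p : ℤ_[p]) • Submodule.mkQ _ v = 0
    rw [← map_smul, Submodule.mkQ_apply, Submodule.Quotient.mk_eq_zero]
    exact Submodule.smul_mem_pointwise_smul _ _ _ hv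
  rw [← card_span_eq_top_of_smul_eq_zero h0 (card_map_mkQ_smul n L) N]
  have hspan (s : Fin N → S) : Submodule.span ℤ_[p] (Set.range fun i ↦ (s i : _ ⧸ _)) =
      (Submodule.span ℤ_[p] (Set.range s)).map S.subtype := by
    rw [Submodule.map_span, ← Set.range_comp]; rfl
  have hiff (s : Fin N → S) : Submodule.span ℤ_[p] (Set.range fun i ↦ (s i : _ ⧸ _)) = S ↔
      Submodule.span ℤ_[p] (Set.range s) = ⊤ := by
    rw [hspan]
    constructor
    · intro h
      refine Submodule.map_injective_of_injective S.subtype_injective ?_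
      rw [h, Submodule.map_top, Submodule.range_subtype]
    · intro h
      rw [h, Submodule.map_top, Submodule.range_subtype]
  congr 1
  exact Nat.card_congr
    { toFun := fun t ↦ ⟨fun i ↦ ⟨t.1 i, t.2.le (Submodule.subset_span (Set.mem_range_self i))⟩,
        (hiff _).1 t.2⟩
      invFun := fun s ↦ ⟨fun i ↦ s.1 i, (hiff _).2 s.2⟩
      left_inv := fun _ ↦ rfl
      right_inv := fun _ ↦ rfl }

end Padic

section Padic
variable {p : ℕ} [Fact p.Prime]
open scoped Pointwise Topology
open Filter

/-- The columns of a matrix modulo `p L`. -/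
def colsMkQ (n N : ℕ) (L : Submodule ℤ_[p] (Fin n → ℤ_[p])) :
    Matrix (Fin n) (Fin N) ℤ_[p] →+ (Fin N → (Fin n → ℤ_[p]) ⧸ (p : ℤ_[p]) • L) where
  toFun M j := ((p : ℤ_[p]) • L).mkQ (M.col j)
  map_zero' := funext fun _ ↦ map_zero _
  map_add' A B := funext fun j ↦ map_add _ (A.col j) (B.col j)

theorem colsMkQ_surjective (n N : ℕ) (L : Submodule ℤ_[p] (Fin n → ℤ_[p])) :
    Function.Surjective (colsMkQ n N L) := fun t ↦ by
  choose v hv using fun j ↦ Submodule.mkQ_surjective _ (t j)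
  exact ⟨Matrix.of fun i j ↦ v j i, funext hv⟩

theorem PadicInt.dvd_of_norm_le {a k : ℤ_[p]} (hk : k ≠ 0) (h : ‖a‖ ≤ ‖k‖) : ∃ b, k * b = a := by
  have hk' : (k : ℚ_[p]) ≠ 0 := fun h ↦ hk (Subtype.ext h)
  refine ⟨⟨a / k, ?_⟩, Subtype.ext ?_⟩
  · rw [norm_div]
    exact div_le_one_of_le₀ h (norm_nonneg _)
  · change (k : ℚ_[p]) * (a / k) = a
    field_simp

theorem finite_quotient_smul (n : ℕ) (L : Submodule ℤ_[p] (Fin n → ℤ_[p]))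
    [Finite ((Fin n → ℤ_[p]) ⧸ L)] : Finite ((Fin n → ℤ_[p]) ⧸ (p : ℤ_[p]) • L) := by
  refine Nat.finite_of_card_ne_zero ?_
  rw [card_quotient_smul]
  exact mul_ne_zero Nat.card_pos.ne' (pow_ne_zero _ (Fact.out : p.Prime).ne_zero)

theorem isOpen_ker_colsMkQ (n N : ℕ) (L : Submodule ℤ_[p] (Fin n → ℤ_[p]))
    [Finite ((Fin n → ℤ_[p]) ⧸ L)] : IsOpen ((colsMkQ n N L).ker : Set (Matrix (Fin n) (Fin N) ℤ_[p])) := by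
  have := finite_quotient_smul n L
  set k := Nat.card ((Fin n → ℤ_[p]) ⧸ (p : ℤ_[p]) • L) with hk
  have hk0 : (k : ℤ_[p]) ≠ 0 := Nat.cast_ne_zero.2 Nat.card_pos.ne'
  refine AddSubgroup.isOpen_of_mem_nhds _ (g := 0) ?_
  have hev : ∀ᶠ M : Matrix (Fin n) (Fin N) ℤ_[p] in 𝓝 0, ∀ i j, ‖M i j‖ < ‖(k : ℤ_[p])‖ := by
    refine eventually_all.2 fun i ↦ eventually_all.2 fun j ↦ ?_
    have hc : Continuous fun M : Matrix (Fin n) (Fin N) ℤ_[p] ↦ ‖M i j‖ :=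
      (continuous_id.matrix_elem i j).norm
    refine hc.continuousAt.eventually (gt_mem_nhds ?_)
    simpa using hk0
  filter_upwards [hev] with M hM
  choose b hb using fun i j ↦ PadicInt.dvd_of_norm_le hk0 (hM i j).le
  refine (AddMonoidHom.mem_ker).2 (funext fun j ↦ ?_)
  have hcol : M.col j = k • fun i ↦ b i j := by
    funext i
    simp [← hb i j]
  change Submodule.mkQ _ (M.col j) = 0
  rw [hcol, map_nsmul, hk, card_nsmul_eq_zero']

theorem measureReal_preimage_colsMkQ {n N : ℕ} (μ : Measure (Matrix (Fin n) (Fin N) ℤ_[p]))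
    [μ.IsAddLeftInvariant] [IsProbabilityMeasure μ] (L : Submodule ℤ_[p] (Fin n → ℤ_[p]))
    [Finite ((Fin n → ℤ_[p]) ⧸ L)] (T : Set (Fin N → (Fin n → ℤ_[p]) ⧸ (p : ℤ_[p]) • L)) :
    MeasurableSet (colsMkQ n N L ⁻¹' T) ∧ μ.real (colsMkQ n N L ⁻¹' T) =
      Nat.card T / (Nat.card ((Fin n → ℤ_[p]) ⧸ L) * (p : ℝ) ^ n) ^ N := by
  have := finite_quotient_smul n L
  have h := measureReal_preimage_eq μ (colsMkQ n N L) (colsMkQ_surjective n N L)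
    (isOpen_ker_colsMkQ n N L) T
  rw [Nat.card_fun, card_quotient_smul, Nat.card_fin] at h
  exact_mod_cast h

/-- The probability that the columns of a matrix generate a given lattice. -/
theorem measureReal_range_mulVecLin_eq {n N : ℕ} (μ : Measure (Matrix (Fin n) (Fin N) ℤ_[p]))
    [μ.IsAddLeftInvariant] [IsProbabilityMeasure μ] (L : Submodule ℤ_[p] (Fin n → ℤ_[p]))
    [Finite ((Fin n → ℤ_[p]) ⧸ L)] :
    MeasurableSet {M : Matrix (Fin n) (Fin N) ℤ_[p] | LinearMap.range M.mulVecLin = L} ∧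
    μ.real {M : Matrix (Fin n) (Fin N) ℤ_[p] | LinearMap.range M.mulVecLin = L} =
      (∏ i ∈ Finset.range n, ((p : ℝ) ^ N - (p : ℝ) ^ i)) /
        (Nat.card ((Fin n → ℤ_[p]) ⧸ L) * (p : ℝ) ^ n) ^ N := by
  have h := measureReal_preimage_colsMkQ μ L
    {t | Submodule.span ℤ_[p] (Set.range t) = L.map ((p : ℤ_[p]) • L).mkQ}
  have hset : colsMkQ n N L ⁻¹'
      {t | Submodule.span ℤ_[p] (Set.range t) = L.map ((p : ℤ_[p]) • L).mkQ} =
      {M : Matrix (Fin n) (Fin N) ℤ_[p] | LinearMap.range M.mulVecLin = L} := by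
    ext M
    have hr : Set.range (colsMkQ n N L M) = ((p : ℤ_[p]) • L).mkQ '' Set.range M.col :=
      Set.range_comp ((p : ℤ_[p]) • L).mkQ M.col
    rw [Set.mem_preimage, Set.mem_ofPred_eq, Set.mem_ofPred_eq, hr, ← Submodule.map_span,
      map_mkQ_smul_eq_iff (IsNoetherian.noetherian L), Matrix.range_mulVecLin]
  rw [hset] at h
  refine ⟨h.1, h.2.trans ?_⟩
  rw [← card_span_eq_map_mkQ n N L]
  rfl

/-- The probability that the cokernel is isomorphic to `G`, times `|Aut G|`. -/
theorem measureReal_coker_mul_card_aut {n N : ℕ} (μ : Measure (Matrix (Fin n) (Fin N) ℤ_[p]))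
    [μ.IsAddLeftInvariant] [IsProbabilityMeasure μ] {G : Type*} [AddCommGroup G] [Module ℤ_[p] G]
    [Finite G] {e : ℕ} (hG : ∀ g : G, p ^ e • g = 0) {r : ℕ}
    (hr : Nat.card (G ⧸ (p : ℤ_[p]) • (⊤ : Submodule ℤ_[p] G)) = p ^ r) :
    μ.real {M | Nonempty (((Fin n → ℤ_[p]) ⧸ LinearMap.range M.mulVecLin) ≃+ G)} *
        Nat.card (G ≃+ G) * (((p : ℝ) ^ r) ^ n * (Nat.card G * (p : ℝ) ^ n) ^ N) =
      (Nat.card G : ℝ) ^ n * (∏ i ∈ Finset.range r, ((p : ℝ) ^ n - (p : ℝ) ^ i)) *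
        ∏ i ∈ Finset.range n, ((p : ℝ) ^ N - (p : ℝ) ^ i) := by
  have h1 := card_span_eq_top hr n
  obtain ⟨h2⟩ := nonempty_quotient_prod_aut_equiv hG n
  have hp : (p : ℝ) ≠ 0 := Nat.cast_ne_zero.2 (Fact.out : p.Prime).ne_zero
  have hc : (Nat.card G : ℝ) ≠ 0 := Nat.cast_ne_zero.2 Nat.card_pos.ne'
  rw [← Nat.card_congr h2, Nat.card_prod] at h1
  set 𝓛 := {L : Submodule ℤ_[p] (Fin n → ℤ_[p]) // Nonempty (((Fin n → ℤ_[p]) ⧸ L) ≃+ G)} with h𝓛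
  have := Finite.of_equiv _ h2.symm
  have : Finite 𝓛 := Finite.prod_left (G ≃+ G)
  have := Fintype.ofFinite 𝓛
  have hq (L : 𝓛) : Finite ((Fin n → ℤ_[p]) ⧸ L.1) := Finite.of_equiv G L.2.some.symm.toEquiv
  have hcard (L : 𝓛) : Nat.card ((Fin n → ℤ_[p]) ⧸ L.1) = Nat.card G :=
    Nat.card_congr L.2.some.toEquiv
  have hset : {M : Matrix (Fin n) (Fin N) ℤ_[p] |
      Nonempty (((Fin n → ℤ_[p]) ⧸ LinearMap.range M.mulVecLin) ≃+ G)} =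
      ⋃ L ∈ (Finset.univ : Finset 𝓛), {M | LinearMap.range M.mulVecLin = L.1} := by
    ext M
    simp only [Set.mem_ofPred_eq, Set.mem_iUnion, Finset.mem_univ, exists_prop, true_and]
    exact ⟨fun h ↦ ⟨⟨_, h⟩, rfl⟩, fun ⟨L, hL⟩ ↦ hL ▸ L.2⟩
  have hμ := measureReal_biUnion_finset (μ := μ) (s := (Finset.univ : Finset 𝓛))
    (f := fun L ↦ {M | LinearMap.range M.mulVecLin = L.1})
    (fun L _ L' _ hL ↦ Set.disjoint_left.2 fun M hM hM' ↦ hL (Subtype.ext (hM.symm.trans hM')))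
    (fun L _ ↦ (measureReal_range_mulVecLin_eq μ L.1).1)
  rw [← hset, Finset.sum_congr rfl fun L _ ↦ (measureReal_range_mulVecLin_eq μ L.1).2] at hμ
  simp only [hcard, Finset.sum_const, Finset.card_univ, nsmul_eq_mul] at hμ
  rw [hμ, ← Nat.card_eq_fintype_card, ← h1]
  push_cast
  field_simp

/-- A lower bound for the order of the automorphism group, in terms of the cokernel
probabilities of square-rank lattices. -/
theorem measureReal_coker_le {r N : ℕ} (μ : Measure (Matrix (Fin r) (Fin N) ℤ_[p]))
    [μ.IsAddLeftInvariant] [IsProbabilityMeasure μ] {G : Type*} [AddCommGroup G] [Module ℤ_[p] G]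
    [Finite G] {e : ℕ} (hG : ∀ g : G, p ^ e • g = 0)
    (hr : Nat.card (G ⧸ (p : ℤ_[p]) • (⊤ : Submodule ℤ_[p] G)) = p ^ r) :
    μ.real {M | Nonempty (((Fin r → ℤ_[p]) ⧸ LinearMap.range M.mulVecLin) ≃+ G)} *
      ((p : ℝ) ^ r) ^ N ≤ 1 := by
  have hp : (0 : ℝ) < p := Nat.cast_pos.2 (Fact.out : p.Prime).pos
  have hV := card_quotient_smul r (⊤ : Submodule ℤ_[p] (Fin r → ℤ_[p]))
  have hone : Nat.card ((Fin r → ℤ_[p]) ⧸ (⊤ : Submodule ℤ_[p] (Fin r → ℤ_[p]))) = 1 :=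
    Nat.card_unique
  have hfin := finite_quotient_smul r (⊤ : Submodule ℤ_[p] (Fin r → ℤ_[p]))
  have h0 := (measureReal_preimage_colsMkQ μ (⊤ : Submodule ℤ_[p] (Fin r → ℤ_[p])) {0}).2
  have hle : {M : Matrix (Fin r) (Fin N) ℤ_[p] |
      Nonempty (((Fin r → ℤ_[p]) ⧸ LinearMap.range M.mulVecLin) ≃+ G)} ⊆
      colsMkQ r N (⊤ : Submodule ℤ_[p] (Fin r → ℤ_[p])) ⁻¹' {0} := by
    rintro M ⟨f⟩
    obtain ⟨g, -⟩ := exists_linearEquiv_of_addEquiv hG f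
    let φ : (Fin r → ℤ_[p]) →ₗ[ℤ_[p]] G := g.toLinearMap ∘ₗ (LinearMap.range M.mulVecLin).mkQ
    have hφ : Function.Surjective φ := g.surjective.comp (Submodule.mkQ_surjective _)
    let ψ := Submodule.mapQ ((p : ℤ_[p]) • (⊤ : Submodule ℤ_[p] (Fin r → ℤ_[p])))
      ((p : ℤ_[p]) • (⊤ : Submodule ℤ_[p] G)) φ (by
        rintro _ ⟨v, -, rfl⟩
        exact ⟨φ v, trivial, (map_smul φ _ v).symm⟩)
    have hψ : Function.Surjective ψ := by
      intro y
      obtain ⟨y, rfl⟩ := Submodule.mkQ_surjective _ y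
      obtain ⟨v, rfl⟩ := hφ y
      exact ⟨Submodule.mkQ _ v, rfl⟩
    have hinj : Function.Injective ψ := by
      refine ((Nat.bijective_iff_surjective_and_card ψ).2 ⟨hψ, ?_⟩).1
      rw [hV, hone, one_mul, hr]
    refine funext fun j ↦ hinj ?_
    rw [Pi.zero_apply, map_zero]
    have hmem : M.col j ∈ LinearMap.range M.mulVecLin := by
      rw [Matrix.range_mulVecLin]
      exact Submodule.subset_span (Set.mem_range_self j)
    have : φ (M.col j) = 0 := by
      change g (Submodule.mkQ _ (M.col j)) = 0
      rw [Submodule.mkQ_apply, (Submodule.Quotient.mk_eq_zero _).2 hmem, map_zero]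
    change Submodule.mkQ _ (φ (M.col j)) = 0
    rw [this, map_zero]
  have := measureReal_mono (μ := μ) hle
  rw [h0, hone, Nat.card_unique, Nat.cast_one, one_mul, le_div_iff₀ (by positivity)] at this
  exact this

end Padic

section Estimates
open Filter Topology

/-- Second-order Bonferroni inequalities for `∏_{i<r} (1 - q^{i-n})`. -/
theorem prod_one_sub_bounds {q : ℝ} (hq : 1 < q) (n r : ℕ) :
    let A := ∏ i ∈ Finset.range r, (1 - q⁻¹ ^ n * q ^ i)
    let e := (q ^ r - 1) / (q - 1)
    0 ≤ A ∧ A ≤ 1 ∧ 1 - e * q⁻¹ ^ n ≤ A ∧ A ≤ 1 - e * q⁻¹ ^ n +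
      (q ^ r - 1) * (q ^ r - q) / ((q - 1) * (q ^ 2 - 1)) * (q⁻¹ ^ n) ^ 2 := by
  have hq0 : 0 < q := by linarith
  have h1 : q - 1 ≠ 0 := by linarith
  have h2 : q ^ 2 - 1 ≠ 0 := by nlinarith
  have hu : 0 < q⁻¹ ^ n := by positivity
  induction r with
  | zero => simp
  | succ r ih =>
    simp only at ih ⊢
    rw [Finset.prod_range_succ]
    set A := ∏ i ∈ Finset.range r, (1 - q⁻¹ ^ n * q ^ i) with hA
    set u := q⁻¹ ^ n with hudef
    set e := (q ^ r - 1) / (q - 1) with he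
    set e₂ := (q ^ r - 1) * (q ^ r - q) / ((q - 1) * (q ^ 2 - 1)) with he₂
    have he' : (q ^ (r + 1) - 1) / (q - 1) = e + q ^ r := by
      rw [he, pow_succ]; field_simp; ring
    have he₂' : (q ^ (r + 1) - 1) * (q ^ (r + 1) - q) / ((q - 1) * (q ^ 2 - 1)) =
        e₂ + e * q ^ r := by
      rw [he, he₂, pow_succ]; field_simp; ring
    rw [he', he₂']
    obtain ⟨h0, h1, hl, hr⟩ := ih
    have ha : 0 < u * q ^ r := by positivity
    rcases le_or_gt r n with hrn | hrn
    · have ha1 : u * q ^ r ≤ 1 := by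
        rw [hudef, inv_pow, inv_mul_le_iff₀ (by positivity), mul_one]
        exact pow_le_pow_right₀ hq.le hrn
      refine ⟨mul_nonneg h0 (by linarith), ?_, ?_, ?_⟩
      · nlinarith
      · nlinarith
      · nlinarith
    · have hA0 : A = 0 := by
        refine Finset.prod_eq_zero (i := n) (Finset.mem_range.2 hrn) ?_
        rw [← mul_pow, inv_mul_cancel₀ hq0.ne', one_pow, sub_self]
      rw [hA0] at hl hr ⊢
      refine ⟨by simp, by simp, by nlinarith, by nlinarith⟩

/-- Taylor bounds for a product of geometric series with argument in `[0, 1]`. -/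
theorem inv_prod_one_sub_bounds {b : ℕ → ℝ} (hb0 : ∀ i, 0 ≤ b i) (hb1 : ∀ i, b i < 1) {u : ℝ}
    (hu0 : 0 ≤ u) (hu1 : u ≤ 1) (k : ℕ) :
    let S := ∑ i ∈ Finset.range k, b i
    let F := fun v : ℝ ↦ (∏ i ∈ Finset.range k, (1 - v * b i))⁻¹
    1 + S ≤ F 1 ∧ 1 + S * u ≤ F u ∧ F u ≤ 1 + S * u + (F 1 - 1 - S) * u ^ 2 := by
  induction k with
  | zero => simp
  | succ k ih =>
    simp only [Finset.prod_range_succ, Finset.sum_range_succ, mul_inv] at ih ⊢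
    set S := ∑ i ∈ Finset.range k, b i with hS
    have hS0 : 0 ≤ S := Finset.sum_nonneg fun i _ ↦ hb0 i
    set F1 := (∏ i ∈ Finset.range k, (1 - 1 * b i))⁻¹
    set Fu := (∏ i ∈ Finset.range k, (1 - u * b i))⁻¹
    obtain ⟨h1, h2, h3⟩ := ih
    have hc0 := hb0 k
    have hc1 := hb1 k
    set c := b k
    have huc : u * c < 1 := by nlinarith
    have hg1 : (1 - 1 * c)⁻¹ = 1 + c + c ^ 2 * (1 - c)⁻¹ := by
      have : 1 - c ≠ 0 := by linarith
      rw [one_mul]; field_simp; ring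
    have hgu : (1 - u * c)⁻¹ = 1 + c * u + c ^ 2 * (1 - u * c)⁻¹ * u ^ 2 := by
      have : 1 - u * c ≠ 0 := by linarith
      field_simp; ring
    have hle : (1 - u * c)⁻¹ ≤ (1 - c)⁻¹ := inv_anti₀ (by linarith) (by nlinarith)
    have hpos : 0 < (1 - u * c)⁻¹ := inv_pos.2 (by linarith)
    set κ := c ^ 2 * (1 - c)⁻¹ with hκ
    have hκ0 : 0 ≤ κ := mul_nonneg (sq_nonneg c) (inv_nonneg.2 (by linarith))
    have hgu_le : (1 - u * c)⁻¹ ≤ 1 + c * u + κ * u ^ 2 := by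
      rw [hgu]
      have : c ^ 2 * (1 - u * c)⁻¹ ≤ κ := mul_le_mul_of_nonneg_left hle (sq_nonneg c)
      gcongr
    have hgu_ge : 1 + c * u ≤ (1 - u * c)⁻¹ := by
      rw [hgu]
      have : 0 ≤ c ^ 2 * (1 - u * c)⁻¹ * u ^ 2 := by positivity
      linarith
    rw [hg1]
    obtain ⟨K, hK⟩ : ∃ K, F1 = 1 + S + K := ⟨F1 - 1 - S, by ring⟩
    have hK0 : 0 ≤ K := by linarith
    have h3' : Fu ≤ 1 + S * u + K * u ^ 2 := by rw [hK] at h3; linarith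
    rw [hK]
    have hSc : 0 ≤ S * c := mul_nonneg hS0 hc0
    refine ⟨?_, ?_, ?_⟩
    · nlinarith [mul_nonneg hK0 hc0, mul_nonneg hK0 hκ0, mul_nonneg hS0 hκ0]
    · calc 1 + (S + c) * u ≤ (1 + S * u) * (1 + c * u) := by
            nlinarith [mul_nonneg hSc (sq_nonneg u)]
        _ ≤ _ := mul_le_mul h2 hgu_ge (by positivity) (le_trans (by positivity) h2)
    · calc Fu * (1 - u * c)⁻¹ ≤ (1 + S * u + K * u ^ 2) * (1 + c * u + κ * u ^ 2) :=
            mul_le_mul h3' hgu_le hpos.le (by positivity)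
        _ = 1 + (S + c) * u + (K + κ + S * c + (S * κ + K * c) * u + K * κ * u ^ 2) * u ^ 2 := by
            ring
        _ ≤ 1 + (S + c) * u + (K + κ + S * c + (S * κ + K * c) * 1 + K * κ * 1) * u ^ 2 := by
            have : u ^ 2 ≤ 1 := pow_le_one₀ hu0 hu1
            gcongr
        _ = _ := by ring

/-- The tail `∏_{i>m} (1 - q^{-i})`. -/
def etaTail (q : ℝ) (m : ℕ) : ℝ := ∏' i : ℕ, (1 - q⁻¹ ^ (m + i + 1))

theorem hasSum_pow_tail {q : ℝ} (hq : 1 < q) (m : ℕ) :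
    HasSum (fun i : ℕ ↦ q⁻¹ ^ (m + i + 1)) (q⁻¹ ^ m / (q - 1)) := by
  have h := (hasSum_geometric_of_lt_one (inv_nonneg.2 (by linarith))
    (inv_lt_one_of_one_lt₀ hq)).mul_left (q⁻¹ ^ (m + 1))
  have h0 : q ≠ 0 := by linarith
  have h1 : q - 1 ≠ 0 := by linarith
  have h2 : q⁻¹ ^ m / (q - 1) = q⁻¹ ^ (m + 1) * (1 - q⁻¹)⁻¹ := by
    have : 1 - q⁻¹ = q⁻¹ * (q - 1) := by field_simp
    rw [this, mul_inv, inv_inv, pow_succ]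
    field_simp
  have h3 : (fun i : ℕ ↦ q⁻¹ ^ (m + i + 1)) = fun i ↦ q⁻¹ ^ (m + 1) * q⁻¹ ^ i := by
    funext i; ring
  rw [h2, h3]
  exact h

theorem tendsto_prod_etaTail {q : ℝ} (hq : 1 < q) (m : ℕ) :
    Tendsto (fun k ↦ ∏ i ∈ Finset.range k, (1 - q⁻¹ ^ (m + i + 1))) atTop (𝓝 (etaTail q m)) := by
  have h : Multipliable fun i : ℕ ↦ 1 + -q⁻¹ ^ (m + i + 1) :=
    Real.multipliable_one_add_of_summable (hasSum_pow_tail hq m).summable.neg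
  exact h.hasProd.tendsto_prod_nat

theorem etaTail_pos {q : ℝ} (hq : 1 < q) (m : ℕ) : 0 < etaTail q m := by
  have hs := (hasSum_pow_tail hq m).summable.neg
  have h := Real.rexp_tsum_eq_tprod (f := fun i : ℕ ↦ 1 + -q⁻¹ ^ (m + i + 1)) (fun i ↦ ?_)
    (Real.summable_log_one_add_of_summable hs)
  · exact (Real.exp_pos _).trans_eq h
  · have : q⁻¹ ^ (m + i + 1) < 1 :=
      pow_lt_one₀ (inv_nonneg.2 (by linarith)) (inv_lt_one_of_one_lt₀ hq) (by omega)
    linarith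

theorem etaF_add (q : ℝ) (m k : ℕ) :
    etaF q (m + k) = etaF q m * ∏ i ∈ Finset.range k, (1 - q⁻¹ ^ (m + i + 1)) :=
  Finset.prod_range_add _ _ _

theorem etaF_pos {q : ℝ} (hq : 1 < q) (m : ℕ) : 0 < etaF q m := by
  refine Finset.prod_pos fun i _ ↦ sub_pos.2 ?_
  exact pow_lt_one₀ (inv_nonneg.2 (by linarith)) (inv_lt_one_of_one_lt₀ hq) (by omega)

theorem etaInf_eq {q : ℝ} (hq : 1 < q) (m : ℕ) : etaInf q = etaF q m * etaTail q m := by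
  have h1 : Tendsto (fun k ↦ etaF q k) atTop (𝓝 (etaInf q)) := by
    have h := tendsto_prod_etaTail hq 0
    simpa only [etaF, etaInf, etaTail, zero_add] using h
  have h2 : Tendsto (fun k ↦ etaF q (m + k)) atTop (𝓝 (etaF q m * etaTail q m)) := by
    simp only [etaF_add]
    exact (tendsto_prod_etaTail hq m).const_mul _
  refine tendsto_nhds_unique (h1.comp (tendsto_add_atTop_nat m)) ?_
  simpa only [Function.comp_def, add_comm] using h2

theorem etaTail_le_one {q : ℝ} (hq : 1 < q) (m : ℕ) : etaTail q m ≤ 1 := by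
  refine le_of_tendsto' (tendsto_prod_etaTail hq m) fun k ↦ Finset.prod_le_one ?_ ?_
  · intro i _
    exact sub_nonneg.2 (pow_le_one₀ (inv_nonneg.2 (by linarith)) (inv_le_one_of_one_le₀ hq.le))
  · intro i _
    have : 0 ≤ q⁻¹ ^ (m + i + 1) := pow_nonneg (inv_nonneg.2 (by linarith)) _
    linarith

/-- Taylor bounds for `1 / ∏_{i>m} (1 - u q^{-i})` at `u = q^{-n}`. -/
theorem inv_etaTail_bounds {q : ℝ} (hq : 1 < q) (m n : ℕ) :
    let S := q⁻¹ ^ m / (q - 1)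
    1 + S ≤ (etaTail q m)⁻¹ ∧ 1 + S * q⁻¹ ^ n ≤ (etaTail q (n + m))⁻¹ ∧
      (etaTail q (n + m))⁻¹ ≤
        1 + S * q⁻¹ ^ n + ((etaTail q m)⁻¹ - 1 - S) * (q⁻¹ ^ n) ^ 2 := by
  have hx0 : 0 ≤ q⁻¹ := inv_nonneg.2 (by linarith)
  have hx1 : q⁻¹ < 1 := inv_lt_one_of_one_lt₀ hq
  have key := inv_prod_one_sub_bounds (b := fun i ↦ q⁻¹ ^ (m + i + 1)) (fun i ↦ pow_nonneg hx0 _)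
    (fun i ↦ pow_lt_one₀ hx0 hx1 (by omega)) (pow_nonneg hx0 n) (pow_le_one₀ hx0 hx1.le)
  have hS := (hasSum_pow_tail hq m).tendsto_sum_nat
  have h1 : Tendsto (fun k ↦ (∏ i ∈ Finset.range k, (1 - 1 * q⁻¹ ^ (m + i + 1)))⁻¹) atTop
      (𝓝 (etaTail q m)⁻¹) := by
    simp only [one_mul]
    exact (tendsto_prod_etaTail hq m).inv₀ (etaTail_pos hq m).ne'
  have h2 : Tendsto (fun k ↦ (∏ i ∈ Finset.range k, (1 - q⁻¹ ^ n * q⁻¹ ^ (m + i + 1)))⁻¹) atTop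
      (𝓝 (etaTail q (n + m))⁻¹) := by
    simp only [← pow_add, ← add_assoc]
    exact (tendsto_prod_etaTail hq (n + m)).inv₀ (etaTail_pos hq _).ne'
  exact ⟨le_of_tendsto_of_tendsto' (hS.const_add 1) h1 fun k ↦ (key k).1,
    le_of_tendsto_of_tendsto' ((hS.mul_const _).const_add 1) h2 fun k ↦ (key k).2.1,
    le_of_tendsto_of_tendsto' h2 (((hS.mul_const _).const_add 1).add
      (((h1.sub_const 1).sub hS).mul_const _)) fun k ↦ (key k).2.2⟩

/-- Bounds on the order of `GL_r(F_q)`. -/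
theorem prod_pow_sub_pow_bounds {q : ℝ} (hq : 2 ≤ q) (r : ℕ) :
    let g := ∏ i ∈ Finset.range r, (q ^ r - q ^ i)
    1 ≤ g ∧ q ^ r - 1 ≤ g ∧ (r ≠ 0 → (q ^ r - 1) * (q ^ r - q) ≤ g) := by
  have hstep (i : ℕ) (hi : i < r) : 1 ≤ q ^ r - q ^ i := by
    have h1 : q ^ (i + 1) ≤ q ^ r := pow_le_pow_right₀ (by linarith) hi
    have h2 : 1 ≤ q ^ i := one_le_pow₀ (by linarith)
    rw [pow_succ] at h1
    nlinarith
  refine ⟨Finset.one_le_prod fun i hi ↦ hstep i (Finset.mem_range.1 hi), ?_, ?_⟩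
  · rcases r with _ | r
    · simp
    · rw [Finset.prod_range_succ', pow_zero]
      have h0 := hstep 0 (by omega)
      rw [pow_zero] at h0
      have : 1 ≤ ∏ i ∈ Finset.range r, (q ^ (r + 1) - q ^ (i + 1)) :=
        Finset.one_le_prod fun i hi ↦ hstep _ (by have := Finset.mem_range.1 hi; omega)
      exact le_mul_of_one_le_left (by linarith) this
  · intro hr
    rcases r with _ | _ | r
    · exact absurd rfl hr
    · simp; linarith
    · rw [Finset.prod_range_succ', Finset.prod_range_succ', pow_zero, zero_add, pow_one, mul_assoc,
        mul_comm (q ^ (r + 1 + 1) - 1)]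
      have h0 := hstep 0 (by omega)
      have h1 := hstep 1 (by omega)
      rw [pow_zero] at h0
      rw [pow_one] at h1
      have : 1 ≤ ∏ i ∈ Finset.range r, (q ^ (r + 1 + 1) - q ^ (i + 1 + 1)) :=
        Finset.one_le_prod fun i hi ↦ hstep _ (by have := Finset.mem_range.1 hi; omega)
      exact le_mul_of_one_le_left (mul_nonneg (by linarith) (by linarith)) this

/-- The second-order remainder estimate, from the bounds for the factors. -/
theorem abs_sub_le_of_bounds {w A B e e₂ S K u : ℝ} (hw0 : 0 ≤ w) (hw1 : w ≤ 1) (hS : 0 ≤ S)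
    (hK : 0 ≤ K) (hu : 0 ≤ u) (hwe : w * e ≤ 1) (hwe₂ : w * e₂ ≤ S) (hA0 : 0 ≤ A)
    (hA1 : A ≤ 1) (hAl : 1 - e * u ≤ A) (hAu : A ≤ 1 - e * u + e₂ * u ^ 2)
    (hBl : 1 + S * u ≤ B) (hBu : B ≤ 1 + S * u + K * u ^ 2) :
    |w * A * B - w - w * (S - e) * u| ≤ √((1 + S + K) ^ 2 - 1) * u ^ 2 := by
  have hC : S + K ≤ √((1 + S + K) ^ 2 - 1) := Real.le_sqrt_of_sq_le (by nlinarith)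
  have hl : 1 + (S - e) * u - e * S * u ^ 2 ≤ A * B := by
    calc _ = (1 - e * u) * (1 + S * u) := by ring
      _ ≤ A * (1 + S * u) := by gcongr
      _ ≤ A * B := by gcongr
  have hr : A * B ≤ 1 + (S - e) * u + (e₂ + K) * u ^ 2 := by
    calc A * B ≤ A * (1 + S * u + K * u ^ 2) := by gcongr
      _ = A + A * (S * u + K * u ^ 2) := by ring
      _ ≤ A + 1 * (S * u + K * u ^ 2) := by gcongr
      _ ≤ _ := by linarith
  refine le_trans ?_ (mul_le_mul_of_nonneg_right hC (sq_nonneg u))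
  rw [abs_le]
  have hl' := mul_le_mul_of_nonneg_left hl hw0
  have hr' := mul_le_mul_of_nonneg_left hr hw0
  have hu2 := sq_nonneg u
  constructor
  · have : w * e * S * u ^ 2 ≤ 1 * S * u ^ 2 := by gcongr
    nlinarith [mul_nonneg hK hu2]
  · have h1 : w * e₂ * u ^ 2 ≤ S * u ^ 2 := by gcongr
    have h2 : w * K * u ^ 2 ≤ 1 * K * u ^ 2 := by gcongr
    nlinarith

end Estimates

theorem prod_pow_sub_pow_eq {q : ℝ} (hq : q ≠ 0) (n r : ℕ) :
    ∏ i ∈ Finset.range r, (q ^ n - q ^ i) =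
      (q ^ n) ^ r * ∏ i ∈ Finset.range r, (1 - q⁻¹ ^ n * q ^ i) := by
  calc _ = ∏ i ∈ Finset.range r, q ^ n * (1 - q⁻¹ ^ n * q ^ i) :=
        Finset.prod_congr rfl fun i _ ↦ by
          rw [mul_sub, mul_one, ← mul_assoc, ← mul_pow, mul_inv_cancel₀ hq, one_pow, one_mul]
    _ = _ := by rw [Finset.prod_mul_distrib, Finset.prod_const, Finset.card_range]

section Padic
variable {p : ℕ} [Fact p.Prime]
open scoped Pointwise

/-- The probability that a random cokernel is isomorphic to `G`, as a multiple of its limit. -/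
theorem measureReal_coker_mul_etaTail {n m : ℕ} (μ : Measure (Matrix (Fin n) (Fin (n + m)) ℤ_[p]))
    [μ.IsAddLeftInvariant] [IsProbabilityMeasure μ] {G : Type*} [AddCommGroup G] [Module ℤ_[p] G]
    [Finite G] {e : ℕ} (hG : ∀ g : G, p ^ e • g = 0) {r : ℕ}
    (hr : Nat.card (G ⧸ (p : ℤ_[p]) • (⊤ : Submodule ℤ_[p] G)) = p ^ r) :
    μ.real {M | Nonempty (((Fin n → ℤ_[p]) ⧸ LinearMap.range M.mulVecLin) ≃+ G)} *
        etaTail p (n + m) =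
      (etaInf p / etaF p m) / ((Nat.card G : ℝ) ^ m * (Nat.card (G ≃+ G) : ℝ)) *
        ∏ i ∈ Finset.range r, (1 - (p : ℝ)⁻¹ ^ n * (p : ℝ) ^ i) := by
  have hp : (1 : ℝ) < p := by exact_mod_cast (Fact.out : p.Prime).one_lt
  have hp0 : (p : ℝ) ≠ 0 := by linarith
  have key := measureReal_coker_mul_card_aut μ hG hr
  have hcard : (Nat.card G : ℝ) ≠ 0 := by exact_mod_cast Nat.card_pos.ne'
  have : Finite (G ≃+ G) := .of_injective _ DFunLike.coe_injective
  have haut : (Nat.card (G ≃+ G) : ℝ) ≠ 0 := by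
    have : Nonempty (G ≃+ G) := ⟨.refl G⟩
    exact_mod_cast Nat.card_pos.ne'
  have hB : ∏ i ∈ Finset.range n, (1 - (p : ℝ)⁻¹ ^ (n + m) * (p : ℝ) ^ i) =
      ∏ i ∈ Finset.range n, (1 - (p : ℝ)⁻¹ ^ (m + i + 1)) := by
    rw [← Finset.prod_range_reflect (fun i ↦ 1 - (p : ℝ)⁻¹ ^ (m + i + 1))]
    refine Finset.prod_congr rfl fun i hi ↦ ?_
    have hi := Finset.mem_range.1 hi
    have h : n + m = (m + (n - 1 - i) + 1) + i := by omega
    rw [h, pow_add _ _ i, mul_assoc, ← mul_pow, inv_mul_cancel₀ hp0, one_pow, mul_one]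
  have hF : etaInf p / etaF p m =
      (∏ i ∈ Finset.range n, (1 - (p : ℝ)⁻¹ ^ (m + i + 1))) * etaTail p (n + m) := by
    rw [etaInf_eq hp (m + n), etaF_add, mul_assoc, mul_div_cancel_left₀ _ (etaF_pos hp m).ne',
      add_comm n m]
  rw [hF]
  rw [prod_pow_sub_pow_eq hp0, prod_pow_sub_pow_eq hp0, hB, mul_pow, ← pow_mul (p : ℝ) n r,
    mul_comm n r, pow_mul, ← pow_mul (p : ℝ) (n + m) n, mul_comm (n + m), pow_mul,
    pow_add (Nat.card G : ℝ)] at key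
  rw [div_mul_eq_mul_div, eq_div_iff (mul_ne_zero (pow_ne_zero _ hcard) haut)]
  have h1 : ((p : ℝ) ^ r) ^ n * (Nat.card G : ℝ) ^ n * ((p : ℝ) ^ n) ^ (n + m) ≠ 0 := by
    positivity
  refine mul_left_cancel₀ h1 ?_
  linear_combination etaTail p (n + m) * key

/-- The limiting probability of a cokernel with `r` generators is `O(1 / |GL_r(F_p)|)`. -/
theorem limit_coker_mul_prod_le (m : ℕ) {G : Type*} [AddCommGroup G] [Module ℤ_[p] G]
    [Finite G] {e : ℕ} (hG : ∀ g : G, p ^ e • g = 0) {r : ℕ}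
    (hr : Nat.card (G ⧸ (p : ℤ_[p]) • (⊤ : Submodule ℤ_[p] G)) = p ^ r) :
    (etaInf p / etaF p m) / ((Nat.card G : ℝ) ^ m * (Nat.card (G ≃+ G) : ℝ)) *
      ∏ i ∈ Finset.range r, ((p : ℝ) ^ r - (p : ℝ) ^ i) ≤ ((p : ℝ)⁻¹ ^ m) ^ r := by
  have hp : (1 : ℝ) < p := by exact_mod_cast (Fact.out : p.Prime).one_lt
  have hp0 : (0 : ℝ) < p := by linarith
  let : CompactSpace (Matrix (Fin r) (Fin (r + m)) ℤ_[p]) :=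
    inferInstanceAs (CompactSpace (Fin r → Fin (r + m) → ℤ_[p]))
  let μ : Measure (Matrix (Fin r) (Fin (r + m)) ℤ_[p]) := Measure.addHaarMeasure ⊤
  have : IsProbabilityMeasure μ := ⟨Measure.addHaarMeasure_self (K₀ := ⊤)⟩
  have h1 := measureReal_coker_mul_etaTail μ hG hr
  have h2 := measureReal_coker_le μ hG hr
  set w := (etaInf p / etaF p m) / ((Nat.card G : ℝ) ^ m * (Nat.card (G ≃+ G) : ℝ))
  set P := μ.real {M | Nonempty (((Fin r → ℤ_[p]) ⧸ LinearMap.range M.mulVecLin) ≃+ G)}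
  have hP : P * etaTail p (r + m) ≤ P :=
    mul_le_of_le_one_right measureReal_nonneg (etaTail_le_one hp _)
  rw [prod_pow_sub_pow_eq hp0.ne', mul_left_comm, ← h1, ← pow_mul, ← pow_mul, inv_pow, ← one_div,
    le_div_iff₀ (by positivity)]
  calc _ ≤ (p : ℝ) ^ (r * r) * P * p ^ (m * r) := by gcongr
    _ = P * ((p : ℝ) ^ r) ^ (r + m) := by ring
    _ ≤ 1 := h2

end Padic

/-- For a Haar probability measure `μ` on `Mat_{n×(n+m)}(ℤ_p)` and a finite
abelian `p`-group `G` with `r = dim_{F_p}(G/pG)`,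
`|μ({M : coker M ≅ G}) − w_m(G) − λ_m(G)·p^{−n}| ≤ (η_m(p)²/η_∞(p)² − 1)^{1/2}·p^{−2n}`. -/
theorem stmt0 (p : ℕ) [Fact p.Prime] (m n : ℕ) (hn : 1 ≤ n)
    (μ : Measure (Matrix (Fin n) (Fin (n + m)) ℤ_[p]))
    [μ.IsAddHaarMeasure] [IsProbabilityMeasure μ]
    (G : Type) [AddCommGroup G] [Fintype G]
    (hG : ∀ g : G, ∃ k : ℕ, p ^ k • g = 0)
    (r : ℕ) (hr : Nat.card (G ⧸ (p • AddMonoidHom.id G).range) = p ^ r)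
    (w lam : ℝ)
    (hw : w = (etaInf p / etaF p m) / ((Nat.card G : ℝ) ^ m * (Nat.card (G ≃+ G) : ℝ)))
    (hlam : lam = w * (1 + (p : ℝ)⁻¹ ^ m - (p : ℝ) ^ r) / ((p : ℝ) - 1)) :
    |(μ {M | Nonempty (((Fin n → ℤ_[p]) ⧸ LinearMap.range M.mulVecLin) ≃+ G)}).toReal
        - w - lam * (p : ℝ)⁻¹ ^ n|
      ≤ Real.sqrt (etaF p m ^ 2 / etaInf p ^ 2 - 1) * (p : ℝ)⁻¹ ^ (2 * n) := by
  classical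
  obtain ⟨e, he⟩ : ∃ e, ∀ g : G, p ^ e • g = 0 := by
    choose k hk using hG
    refine ⟨∑ g, k g, fun g ↦ ?_⟩
    rw [← Finset.sum_erase_add _ _ (Finset.mem_univ g), pow_add, mul_smul, hk, smul_zero]
  let := AddCommGroup.zmodModule (n := p ^ e) he
  let : Module ℤ_[p] G := Module.compHom G (PadicInt.toZModPow (p := p) e)
  open scoped Pointwise in
  have hr' : Nat.card (G ⧸ (p : ℤ_[p]) • (⊤ : Submodule ℤ_[p] G)) = p ^ r := by
    rw [← hr]
    have h : ((p : ℤ_[p]) • (⊤ : Submodule ℤ_[p] G)).toAddSubgroup =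
        (p • AddMonoidHom.id G).range := by
      ext g
      rw [Submodule.mem_toAddSubgroup, Submodule.mem_smul_pointwise_iff_exists]
      simp [Nat.cast_smul_eq_nsmul]
    rw [← h]
    rfl
  have hp : (2 : ℝ) ≤ p := by exact_mod_cast (Fact.out : p.Prime).two_le
  have hp1 : (1 : ℝ) < p := by linarith
  have hp0 : (0 : ℝ) < p := by linarith
  have hT := etaTail_pos hp1 m
  have hF := etaF_pos hp1 m
  have hprob := measureReal_coker_mul_etaTail μ he hr'
  have hle := limit_coker_mul_prod_le m he hr'
  rw [← hw] at hprob hle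
  have hw0 : 0 ≤ w := by
    rw [hw, etaInf_eq hp1 m]
    positivity
  obtain ⟨hg1, hge, hge₂⟩ := prod_pow_sub_pow_bounds hp r
  set g := ∏ i ∈ Finset.range r, ((p : ℝ) ^ r - (p : ℝ) ^ i)
  have hx0 : (0 : ℝ) ≤ (p : ℝ)⁻¹ ^ m := by positivity
  have hx1 : (p : ℝ)⁻¹ ^ m ≤ 1 := pow_le_one₀ (by positivity) (inv_le_one_of_one_le₀ hp1.le)
  have hwg : w * g ≤ 1 := hle.trans (pow_le_one₀ hx0 hx1)
  have hpr : (1 : ℝ) ≤ p ^ r := one_le_pow₀ hp1.le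
  have hwe : w * (((p : ℝ) ^ r - 1) / (p - 1)) ≤ 1 := by
    refine le_trans (mul_le_mul_of_nonneg_left ?_ hw0) hwg
    exact (div_le_self (by linarith) (by linarith)).trans hge
  have hwe₂ : w * (((p : ℝ) ^ r - 1) * (p ^ r - p) / ((p - 1) * (p ^ 2 - 1))) ≤
      (p : ℝ)⁻¹ ^ m / (p - 1) := by
    rcases eq_or_ne r 0 with rfl | hr0
    · simp only [pow_zero, sub_self, zero_mul, zero_div, mul_zero]
      exact div_nonneg hx0 (by linarith)
    · have h1 : w * g ≤ (p : ℝ)⁻¹ ^ m := hle.trans (pow_le_of_le_one hx0 hx1 hr0)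
      have h2 := hge₂ hr0
      have h3 : (p : ℝ) ≤ p ^ r := le_self_pow₀ hp1.le hr0
      rw [mul_comm ((p : ℝ) - 1), ← div_div, ← mul_div_assoc]
      refine div_le_div_of_nonneg_right (le_trans (mul_le_mul_of_nonneg_left ?_ hw0) h1)
        (by linarith)
      refine (div_le_self ?_ (by nlinarith)).trans h2
      exact mul_nonneg (by linarith) (by linarith)
  obtain ⟨hA0, hA1, hAl, hAu⟩ := prod_one_sub_bounds hp1 n r
  obtain ⟨hS, hBl, hBu⟩ := inv_etaTail_bounds hp1 m n
  have main := abs_sub_le_of_bounds hw0 ((le_mul_of_one_le_right hw0 hg1).trans hwg)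
    (div_nonneg hx0 (by linarith)) (by linarith) (by positivity) hwe hwe₂ hA0 hA1 hAl hAu hBl hBu
  rw [← hprob, mul_assoc, mul_inv_cancel₀ (etaTail_pos hp1 (n + m)).ne', mul_one] at main
  have hC : (1 + (p : ℝ)⁻¹ ^ m / (p - 1) + ((etaTail p m)⁻¹ - 1 - (p : ℝ)⁻¹ ^ m / (p - 1))) ^ 2 =
      etaF p m ^ 2 / etaInf p ^ 2 := by
    rw [etaInf_eq hp1 m]
    field_simp
    ring
  have hlam' : lam = w * ((p : ℝ)⁻¹ ^ m / (p - 1) - ((p : ℝ) ^ r - 1) / (p - 1)) := by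
    rw [hlam, ← sub_div, mul_div_assoc]
    ring
  rw [hC, ← hlam', ← pow_mul, mul_comm n 2] at main
  exact main
end
end

section
/- Let p be a prime, m ≥ 0 and n ≥ 1 integers, and let μ be the Haar probability measure on the compact additive group Mat_{n×(n+m)}(ℤ_p) of n×(n+m) matrices over the p-adic integers. Let L ⊆ ℤ_p^n be a ℤ_p-submodule of finite index a := [ℤ_p^n : L]. Then the measure of the set of matrices M whose column span equals L is μ({M : M·ℤ_p^{n+m} = L}) = a^{−(n+m)} · ∏_{i=m+1}^{n+m}(1 − p^{−i}). -/
noncomputable section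

open MeasureTheory

namespace MeasureTheory

theorem measureReal_preimage_addMonoidHom {G A : Type*} [AddGroup G] [AddGroup A] [Finite A]
    [MeasurableSpace G] [MeasurableAdd G] (μ : Measure G) [μ.IsAddLeftInvariant]
    [IsProbabilityMeasure μ] (f : G →+ A) (hf : Function.Surjective f)
    (hker : MeasurableSet (f ⁻¹' {0})) (T : Set A) :
    μ.real (f ⁻¹' T) = (Nat.card T : ℝ) / Nat.card A := by
  classical
  have := Fintype.ofFinite A
  have hfib (t : A) : ∃ g : G, f ⁻¹' {t} = (fun x => g + x) ⁻¹' (f ⁻¹' {0}) := by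
    obtain ⟨g, rfl⟩ := hf t
    refine ⟨-g, ?_⟩
    ext x
    simp only [Set.mem_preimage, Set.mem_singleton_iff, map_add, map_neg, neg_add_eq_zero]
    exact eq_comm
  have hmeas (t : A) : MeasurableSet (f ⁻¹' {t}) := by
    obtain ⟨g, hg⟩ := hfib t
    rw [hg]
    exact measurable_const_add g hker
  have hreal (t : A) : μ.real (f ⁻¹' {t}) = μ.real (f ⁻¹' {0}) := by
    obtain ⟨g, hg⟩ := hfib t
    rw [hg, measureReal_def, measure_preimage_add, measureReal_def]
  have hcount (S : Set A) : μ.real (f ⁻¹' S) = Nat.card S * μ.real (f ⁻¹' {0}) := by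
    have hS : f ⁻¹' S = ⋃ t ∈ S.toFinset, f ⁻¹' {t} := by
      ext x
      simp
    rw [hS, measureReal_biUnion_finset _ fun t _ => hmeas t]
    · simp [hreal]
    · intro s _ t _ hst
      exact Disjoint.preimage f (by simpa using hst)
  have huniv := hcount Set.univ
  rw [Set.preimage_univ, probReal_univ, Nat.card_congr (Equiv.Set.univ A)] at huniv
  have hA : (Nat.card A : ℝ) ≠ 0 := by
    exact_mod_cast Nat.card_pos.ne'
  rw [hcount T, eq_div_iff hA, mul_assoc, mul_comm _ (Nat.card A : ℝ), ← huniv, mul_one]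

theorem measureReal_image_addMonoidHom {G : Type*} [AddGroup G] [TopologicalSpace G]
    [IsTopologicalAddGroup G] [CompactSpace G] [T2Space G] [MeasurableSpace G] [BorelSpace G]
    (μ : Measure G) [μ.IsAddHaarMeasure] [IsProbabilityMeasure μ] (f : G →+ G)
    (hf : Continuous f) (hinj : Function.Injective f) (S : Set G) :
    μ.real (f '' S) = μ.real (Set.range f) * μ.real S := by
  have he : MeasurableEmbedding f := (hf.isClosedEmbedding hinj).measurableEmbedding
  have := Measure.IsAddLeftInvariant.comap μ he
  have hfin : IsFiniteMeasure (μ.comap f) :=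
    ⟨by rw [he.comap_apply]; exact measure_lt_top _ _⟩
  have hsmul := Measure.isAddInvariant_eq_smul_of_compactSpace (μ.comap f) μ
  have hreal (U : Set G) :
      μ.real (f '' U) = Measure.addHaarScalarFactor (μ.comap f) μ * μ.real U := by
    have hU := congrArg (fun ν : Measure G => ν U) hsmul
    rw [measureReal_def, ← he.comap_apply, hU]
    simp [measureReal_def]
  rw [hreal S, ← Set.image_univ, hreal Set.univ, probReal_univ, mul_one]

end MeasureTheory

namespace Matrix

theorem range_mulVecLin_eq_top_iff_linearIndependent_row {K : Type*} [Field K] {k l : ℕ}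
    (M : Matrix (Fin k) (Fin l) K) :
    LinearMap.range M.mulVecLin = ⊤ ↔ LinearIndependent K M.row := by
  rw [linearIndependent_iff_card_eq_finrank_span, Set.finrank, ← rank_eq_finrank_span_row, rank,
    Fintype.card_fin]
  constructor
  · intro h
    rw [h, finrank_top, Module.finrank_fin_fun]
  · intro h
    exact Submodule.eq_top_of_finrank_eq (by rw [← h, Module.finrank_fin_fun])

theorem card_range_mulVecLin_eq_top (p : ℕ) [Fact p.Prime] (m n : ℕ) :
    Nat.card {M : Matrix (Fin n) (Fin (n + m)) (ZMod p) | LinearMap.range M.mulVecLin = ⊤}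
      = ∏ i : Fin n, (p ^ (n + m) - p ^ (i : ℕ)) := by
  have h := card_linearIndependent (K := ZMod p) (V := Fin (n + m) → ZMod p) (k := n) (by simp)
  rw [Module.finrank_fin_fun, ZMod.card] at h
  rw [← h]
  exact Nat.card_congr
    (Equiv.subtypeEquivRight range_mulVecLin_eq_top_iff_linearIndependent_row)

theorem range_mul_mulVecLin_eq_iff {R : Type*} [CommRing R] {k l : ℕ}
    {B : Matrix (Fin k) (Fin k) R} (hB : Function.Injective B.mulVecLin)
    (M : Matrix (Fin k) (Fin l) R) :
    LinearMap.range (B * M).mulVecLin = LinearMap.range B.mulVecLin ↔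
      LinearMap.range M.mulVecLin = ⊤ := by
  rw [mulVecLin_mul, LinearMap.range_comp, LinearMap.range_eq_map B.mulVecLin]
  exact (Submodule.map_injective_of_injective hB).eq_iff

theorem exists_eq_mul_of_col_mem {R : Type*} [CommRing R] {k l : ℕ}
    {B : Matrix (Fin k) (Fin k) R} {M : Matrix (Fin k) (Fin l) R}
    (h : ∀ j, M.col j ∈ LinearMap.range B.mulVecLin) : ∃ N, B * N = M := by
  choose v hv using h
  refine ⟨(Matrix.of v)ᵀ, ?_⟩
  ext i j
  exact congrFun (hv j) i

end Matrix

namespace PadicInt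

variable {p : ℕ} [Fact p.Prime]

theorem toZMod_surjective : Function.Surjective (toZMod : ℤ_[p] →+* ZMod p) :=
  ZMod.ringHom_surjective _

theorem exists_matrix_range_eq {n : ℕ} (L : Submodule ℤ_[p] (Fin n → ℤ_[p]))
    [Finite ((Fin n → ℤ_[p]) ⧸ L)] :
    ∃ B : Matrix (Fin n) (Fin n) ℤ_[p],
      Function.Injective B.mulVecLin ∧ LinearMap.range B.mulVecLin = L := by
  have htors : Module.finrank ℤ_[p] ((Fin n → ℤ_[p]) ⧸ L) = 0 := by
    rw [Module.finrank_eq_zero_iff]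
    intro x
    refine ⟨Nat.card ((Fin n → ℤ_[p]) ⧸ L), ?_, ?_⟩
    · exact_mod_cast Nat.card_pos.ne'
    · rw [Nat.cast_smul_eq_nsmul]
      exact card_nsmul_eq_zero'
  have hrank := L.finrank_quotient_add_finrank
  rw [htors, zero_add, Module.finrank_fin_fun] at hrank
  let e : (Fin n → ℤ_[p]) ≃ₗ[ℤ_[p]] L :=
    LinearEquiv.ofFinrankEq _ _ (by rw [hrank, Module.finrank_fin_fun])
  refine ⟨LinearMap.toMatrix' (L.subtype ∘ₗ e.toLinearMap), ?_, ?_⟩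
  · rw [← Matrix.toLin'_apply', Matrix.toLin'_toMatrix']
    exact L.injective_subtype.comp e.injective
  · rw [← Matrix.toLin'_apply', Matrix.toLin'_toMatrix', LinearMap.range_comp, e.range,
      Submodule.map_top, Submodule.range_subtype]

theorem range_mulVecLin_eq_top_iff {k l : ℕ} (M : Matrix (Fin k) (Fin l) ℤ_[p]) :
    LinearMap.range M.mulVecLin = ⊤ ↔ LinearMap.range (M.map toZMod).mulVecLin = ⊤ := by
  have hmap (v : Fin l → ℤ_[p]) :
      toZMod ∘ (M.mulVecLin v) = (M.map toZMod).mulVecLin (toZMod ∘ v) := by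
    ext i
    exact RingHom.map_mulVec toZMod M v i
  constructor
  · rw [LinearMap.range_eq_top, LinearMap.range_eq_top]
    intro h w
    obtain ⟨y, rfl⟩ := toZMod_surjective.comp_left w
    obtain ⟨x, rfl⟩ := h y
    exact ⟨toZMod ∘ x, (hmap x).symm⟩
  · rw [LinearMap.range_eq_top]
    intro h
    rw [← top_le_iff]
    refine Submodule.le_of_le_smul_of_le_jacobson_bot (I := IsLocalRing.maximalIdeal ℤ_[p])
      Module.Finite.fg_top (IsLocalRing.maximalIdeal_le_jacobson _) ?_
    intro y _
    obtain ⟨w, hw⟩ := h (toZMod ∘ y)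
    obtain ⟨x, rfl⟩ := toZMod_surjective.comp_left w
    have hmem (i : Fin k) : (y - M.mulVecLin x) i ∈ IsLocalRing.maximalIdeal ℤ_[p] := by
      rw [← ker_toZMod, RingHom.mem_ker, Pi.sub_apply, map_sub, sub_eq_zero]
      exact (congrFun ((hmap x).trans hw) i).symm
    rw [← add_sub_cancel (M.mulVecLin x) y]
    refine Submodule.add_mem_sup (LinearMap.mem_range_self _ x) ?_
    rw [← Finset.univ_sum_single (y - M.mulVecLin x)]
    refine Submodule.sum_mem _ fun i _ => ?_
    rw [← mul_one ((y - M.mulVecLin x) i), ← smul_eq_mul, Pi.single_smul]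
    exact Submodule.smul_mem_smul (hmem i) trivial

theorem isOpen_toZMod_preimage_zero : IsOpen ((toZMod : ℤ_[p] →+* ZMod p) ⁻¹' {0}) := by
  have h : (toZMod : ℤ_[p] →+* ZMod p) ⁻¹' {0} = {x | ‖x‖ < 1} := by
    ext x
    rw [Set.mem_preimage, Set.mem_singleton_iff, ← RingHom.mem_ker, ker_toZMod,
      IsLocalRing.mem_maximalIdeal, mem_nonunits, Set.mem_ofPred_eq]
  rw [h]
  exact isOpen_lt continuous_norm continuous_const

theorem compactSpace_matrix (k l : ℕ) : CompactSpace (Matrix (Fin k) (Fin l) ℤ_[p]) :=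
  inferInstanceAs (CompactSpace (Fin k → Fin l → ℤ_[p]))

theorem measureReal_range_mulVecLin_eq_top (m n : ℕ)
    (μ : Measure (Matrix (Fin n) (Fin (n + m)) ℤ_[p])) [μ.IsAddHaarMeasure]
    [IsProbabilityMeasure μ] :
    μ.real {M | LinearMap.range M.mulVecLin = ⊤}
      = ∏ i ∈ Finset.Icc (m + 1) (n + m), (1 - (p : ℝ)⁻¹ ^ i) := by
  let f : Matrix (Fin n) (Fin (n + m)) ℤ_[p] →+ Matrix (Fin n) (Fin (n + m)) (ZMod p) :=
    (toZMod : ℤ_[p] →+* ZMod p).toAddMonoidHom.mapMatrix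
  have hf : Function.Surjective f := fun N => by
    choose g hg using toZMod_surjective (p := p)
    exact ⟨N.map g, by ext i j; exact hg _⟩
  have hker : MeasurableSet (f ⁻¹' {0}) := by
    have h : f ⁻¹' {0} = ⋂ i, ⋂ j, (fun M => M i j) ⁻¹' (toZMod ⁻¹' {0}) := by
      ext M
      simp [f, ← Matrix.ext_iff]
    rw [h]
    exact (isOpen_iInter_of_finite fun i => isOpen_iInter_of_finite fun j =>
      isOpen_toZMod_preimage_zero.preimage (continuous_id.matrix_elem i j)).measurableSet
  have hS : {M : Matrix (Fin n) (Fin (n + m)) ℤ_[p] | LinearMap.range M.mulVecLin = ⊤}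
      = f ⁻¹' {N | LinearMap.range N.mulVecLin = ⊤} :=
    Set.ext range_mulVecLin_eq_top_iff
  have hp : (p : ℝ) ≠ 0 := by exact_mod_cast (Fact.out : p.Prime).ne_zero
  rw [hS, measureReal_preimage_addMonoidHom μ f hf hker, Matrix.card_range_mulVecLin_eq_top]
  have hcard : Nat.card (Matrix (Fin n) (Fin (n + m)) (ZMod p)) = ∏ _i : Fin n, p ^ (n + m) := by
    rw [Matrix, Nat.card_fun, Nat.card_fun]
    simp
  rw [hcard, Nat.cast_prod, Nat.cast_prod, ← Finset.prod_div_distrib]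
  have hterm (i : Fin n) : ((p ^ (n + m) - p ^ (i : ℕ) : ℕ) : ℝ) / ((p ^ (n + m) : ℕ) : ℝ)
      = 1 - (p : ℝ)⁻¹ ^ (n + m - i) := by
    have hi : (i : ℕ) ≤ n + m := by lia
    rw [Nat.cast_sub (Nat.pow_le_pow_right (Fact.out : p.Prime).pos hi), Nat.cast_pow, Nat.cast_pow,
      sub_div, div_self (pow_ne_zero _ hp), inv_pow, pow_sub₀ _ hp hi]
    field_simp
  rw [Finset.prod_congr rfl fun i _ => hterm i,
    Fin.prod_univ_eq_prod_range (fun i => 1 - (p : ℝ)⁻¹ ^ (n + m - i)) n]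
  refine Finset.prod_bij' (fun i _ => n + m - i) (fun i _ => n + m - i) ?_ ?_ ?_ ?_ ?_ <;>
    simp only [Finset.mem_range, Finset.mem_Icc] <;> intros <;> first | rfl | lia

theorem measureReal_range_mul_left (m n : ℕ)
    (μ : Measure (Matrix (Fin n) (Fin (n + m)) ℤ_[p])) [μ.IsAddHaarMeasure]
    [IsProbabilityMeasure μ] (B : Matrix (Fin n) (Fin n) ℤ_[p])
    [Finite ((Fin n → ℤ_[p]) ⧸ LinearMap.range B.mulVecLin)] :
    μ.real (Set.range fun M : Matrix (Fin n) (Fin (n + m)) ℤ_[p] => B * M)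
      = (Nat.card ((Fin n → ℤ_[p]) ⧸ LinearMap.range B.mulVecLin) : ℝ)⁻¹ ^ (n + m) := by
  have := compactSpace_matrix (p := p) n (n + m)
  let f : Matrix (Fin n) (Fin (n + m)) ℤ_[p] →+
      (Fin (n + m) → (Fin n → ℤ_[p]) ⧸ LinearMap.range B.mulVecLin) :=
    { toFun := fun M j => (LinearMap.range B.mulVecLin).mkQ (M.col j)
      map_zero' := by ext j; exact map_zero _
      map_add' := fun M N => by ext j; exact map_add _ (M.col j) (N.col j) }
  have hf : Function.Surjective f := fun w => by
    choose g hg using (LinearMap.range B.mulVecLin).mkQ_surjective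
    exact ⟨(Matrix.of fun j => g (w j)).transpose, funext fun j => hg (w j)⟩
  have hrange : (Set.range fun M : Matrix (Fin n) (Fin (n + m)) ℤ_[p] => B * M) = f ⁻¹' {0} := by
    ext M
    have hM : M ∈ f ⁻¹' {0} ↔ ∀ j, M.col j ∈ LinearMap.range B.mulVecLin := by
      simp only [Set.mem_preimage, Set.mem_singleton_iff, funext_iff]
      exact forall_congr' fun j => Submodule.Quotient.mk_eq_zero _
    rw [hM]
    constructor
    · rintro ⟨N, rfl⟩ j
      exact ⟨N.col j, rfl⟩
    · exact Matrix.exists_eq_mul_of_col_mem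
  have hclosed : IsClosed (Set.range fun M : Matrix (Fin n) (Fin (n + m)) ℤ_[p] => B * M) :=
    (isCompact_range (continuous_const.matrix_mul continuous_id)).isClosed
  have hker : MeasurableSet (f ⁻¹' {0}) := hrange ▸ hclosed.measurableSet
  rw [hrange, measureReal_preimage_addMonoidHom μ f hf hker, Nat.card_fun]
  simp

end PadicInt

/-- For a Haar probability measure `μ` on `Mat_{n×(n+m)}(ℤ_p)` and a
`ℤ_p`-submodule `L ⊆ ℤ_p^n` of finite index `a`, the set of matrices whose column span is `L`
has measure `a^{−(n+m)} · ∏_{i=m+1}^{n+m} (1 − p^{−i})`. -/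
theorem stmt2 (p : ℕ) [Fact p.Prime] (m n : ℕ) (hn : 1 ≤ n)
    (μ : Measure (Matrix (Fin n) (Fin (n + m)) ℤ_[p]))
    [μ.IsAddHaarMeasure] [IsProbabilityMeasure μ]
    (L : Submodule ℤ_[p] (Fin n → ℤ_[p]))
    (a : ℕ) (ha : Nat.card ((Fin n → ℤ_[p]) ⧸ L) = a) (hapos : 0 < a) :
    (μ {M | LinearMap.range M.mulVecLin = L}).toReal
      = (a : ℝ)⁻¹ ^ (n + m) * ∏ i ∈ Finset.Icc (m + 1) (n + m), (1 - (p : ℝ)⁻¹ ^ i) := by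
  have hfin : Finite ((Fin n → ℤ_[p]) ⧸ L) := Nat.finite_of_card_ne_zero (by lia)
  obtain ⟨B, hB, rfl⟩ := PadicInt.exists_matrix_range_eq L
  have := PadicInt.compactSpace_matrix (p := p) n (n + m)
  let φ : Matrix (Fin n) (Fin (n + m)) ℤ_[p] →+ Matrix (Fin n) (Fin (n + m)) ℤ_[p] :=
    { toFun := fun M => B * M
      map_zero' := Matrix.mul_zero B
      map_add' := Matrix.mul_add B }
  have hφ : Function.Injective φ := fun M N h => by
    ext i j
    exact congrFun (@hB (M.col j) (N.col j) (congrArg (fun P => P.col j) h)) i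
  have himage : {M | LinearMap.range M.mulVecLin = LinearMap.range B.mulVecLin}
      = φ '' {M | LinearMap.range M.mulVecLin = ⊤} := by
    ext M
    constructor
    · intro hM
      obtain ⟨N, rfl⟩ := Matrix.exists_eq_mul_of_col_mem (B := B) (M := M) fun j =>
        (show LinearMap.range M.mulVecLin = LinearMap.range B.mulVecLin from hM) ▸
          ⟨Pi.single j 1, M.mulVec_single_one j⟩
      exact ⟨N, (Matrix.range_mul_mulVecLin_eq_iff hB N).1 hM, rfl⟩
    · rintro ⟨N, hN, rfl⟩
      exact (Matrix.range_mul_mulVecLin_eq_iff hB N).2 hN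
  rw [← measureReal_def, himage, measureReal_image_addMonoidHom μ φ
    (continuous_const.matrix_mul continuous_id) hφ,
    PadicInt.measureReal_range_mulVecLin_eq_top, ← ha]
  congr 1
  exact PadicInt.measureReal_range_mul_left m n μ B
end
end

section
/- For all real numbers q > 1 and m > −1, the operator μ ↦ μP_m on ℓ²(π_m) is Hilbert–Schmidt (in particular compact) and self-adjoint; its set of eigenvalues is exactly {q^{−k} : k = 0, 1, 2, …}, and each eigenspace is one-dimensional. -/
noncomputable section

open scoped ENNReal

/-- The tridiagonal transition matrix `P_m` for real `q > 1`, `m > -1`. -/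
def Pm (q m : ℝ) (i j : ℕ) : ℝ :=
  if j = i + 1 then q ^ (-1 - 2 * (i : ℝ) - m)
  else if j = i then
    1 - (1 - q ^ (-(i : ℝ))) * (1 - q ^ (-m - (i : ℝ))) - q ^ (-1 - 2 * (i : ℝ) - m)
  else if i = j + 1 then (1 - q ^ (-(i : ℝ))) * (1 - q ^ (-m - (i : ℝ)))
  else 0

/-- Unnormalized weight `q^{-i(i+m)} / (η_i(q)·∏_{j=1}^{i}(1-q^{-m-j}))`. -/
def piWt (q m : ℝ) (i : ℕ) : ℝ :=
  q ^ (-((i : ℝ) * ((i : ℝ) + m))) /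
    ((∏ j ∈ Finset.range i, (1 - q ^ (-((j : ℝ) + 1)))) *
      ∏ j ∈ Finset.range i, (1 - q ^ (-m - ((j : ℝ) + 1))))

/-- The stationary distribution `π_m`, normalized so that it sums to `1`. -/
def piM (q m : ℝ) (i : ℕ) : ℝ := (∑' k : ℕ, piWt q m k)⁻¹ * piWt q m i

open InnerProductSpace Filter Topology

section Jacobi

/-- The `n`-th summand of the Jacobi operator with diagonal `a` and off-diagonal `b`, where `b n`
couples the coordinates `n - 1` and `n`. -/
def jacobiTerm (a b : ℕ → ℝ) (n : ℕ) :
    lp (fun _ : ℕ => ℂ) 2 →L[ℂ] lp (fun _ : ℕ => ℂ) 2 :=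
  (a n : ℂ) • rankOne ℂ (lp.single 2 n 1) (lp.single 2 n 1) +
    (b n : ℂ) • (rankOne ℂ (lp.single 2 n 1) (lp.single 2 (n - 1) 1) +
      rankOne ℂ (lp.single 2 (n - 1) 1) (lp.single 2 n 1))

/-- The bounded Jacobi operator on `ℓ²(ℕ, ℂ)` with summable diagonal `a` and off-diagonal `b`. -/
def jacobiOp (a b : ℕ → ℝ) : lp (fun _ : ℕ => ℂ) 2 →L[ℂ] lp (fun _ : ℕ => ℂ) 2 :=
  ∑' n, jacobiTerm a b n

theorem norm_single_one (n : ℕ) : ‖(lp.single 2 n 1 : lp (fun _ : ℕ => ℂ) 2)‖ = 1 := by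
  rw [lp.norm_single (by norm_num)]; simp

theorem norm_jacobiTerm_le (a b : ℕ → ℝ) (n : ℕ) :
    ‖jacobiTerm a b n‖ ≤ |a n| + |b n| * 2 := by
  unfold jacobiTerm
  refine (norm_add_le _ _).trans ?_
  rw [norm_smul, norm_smul]
  gcongr
  · simp [norm_rankOne]
  · simp
  · refine (norm_add_le _ _).trans ?_
    simp only [norm_rankOne, norm_single_one]
    norm_num

theorem summable_jacobiTerm {a b : ℕ → ℝ} (ha : Summable fun n => |a n|)
    (hb : Summable fun n => |b n|) : Summable (jacobiTerm a b) :=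
  Summable.of_norm_bounded (ha.add (hb.mul_right 2)) (norm_jacobiTerm_le a b)

theorem isCompactOperator_rankOne (x y : lp (fun _ : ℕ => ℂ) 2) :
    IsCompactOperator (rankOne ℂ x y) := by
  have h : IsCompactOperator (ContinuousLinearMap.toSpanSingleton ℂ x) :=
    isCompactOperator_of_locallyCompactSpace_rng _
  exact h.comp_clm (innerSL ℂ y)

theorem isCompactOperator_jacobiOp {a b : ℕ → ℝ} (ha : Summable fun n => |a n|)
    (hb : Summable fun n => |b n|) : IsCompactOperator (jacobiOp a b) := by
  refine isCompactOperator_of_tendsto (summable_jacobiTerm ha hb).hasSum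
    (Eventually.of_forall fun s => ?_)
  refine Finset.sum_induction (jacobiTerm a b) (fun T => IsCompactOperator T)
    (fun _ _ h₁ h₂ => h₁.add h₂) isCompactOperator_zero fun n _ => ?_
  exact ((isCompactOperator_rankOne _ _).smul (a n : ℂ)).add
    (((isCompactOperator_rankOne _ _).add (isCompactOperator_rankOne _ _)).smul (b n : ℂ))

theorem isSelfAdjoint_jacobiOp (a b : ℕ → ℝ) : IsSelfAdjoint (jacobiOp a b) := by
  unfold jacobiOp
  rw [IsSelfAdjoint, tsum_star]
  congr 1 with n : 1
  simp only [jacobiTerm, star_add, star_smul, ContinuousLinearMap.star_eq_adjoint,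
    adjoint_rankOne, RCLike.star_def, Complex.conj_ofReal]
  rw [add_comm (rankOne ℂ (lp.single 2 (n - 1) 1) (lp.single 2 n 1))]

theorem jacobiTerm_apply (a b : ℕ → ℝ) (n : ℕ) (f : lp (fun _ : ℕ => ℂ) 2) (j : ℕ) :
    jacobiTerm a b n f j =
      (if j = n then (a n : ℂ) * f n else 0) + ((if j = n then (b n : ℂ) * f (n - 1) else 0) +
        if j = n - 1 then (b n : ℂ) * f n else 0) := by
  simp only [jacobiTerm, add_apply, smul_apply,
    rankOne_apply, lp.inner_single_left, lp.coeFn_add, lp.coeFn_smul, Pi.add_apply, Pi.smul_apply,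
    lp.single_apply, Pi.single_apply]
  split_ifs <;> simp [mul_add]

theorem jacobiOp_apply {a b : ℕ → ℝ} (ha : Summable fun n => |a n|)
    (hb : Summable fun n => |b n|) (hb0 : b 0 = 0) (f : lp (fun _ : ℕ => ℂ) 2) (j : ℕ) :
    jacobiOp a b f j = a j * f j + (b j * f (j - 1) + b (j + 1) * f (j + 1)) := by
  have h₁ : HasSum (fun n => jacobiTerm a b n f j) (jacobiOp a b f j) :=
    have h := (summable_jacobiTerm ha hb).hasSum
    have h' := h.mapL (ContinuousLinearMap.apply ℂ (lp (fun _ : ℕ => ℂ) 2) f)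
    h'.mapL (lp.evalCLM ℂ (fun _ : ℕ => ℂ) 2 j)
  have h₂ : HasSum (fun n => if j = n then (a n : ℂ) * f n else 0) (a j * f j) := by
    convert hasSum_single (f := fun n => if j = n then (a n : ℂ) * f n else 0) j
      (fun n hn => if_neg hn.symm) using 1
    simp
  have h₃ : HasSum (fun n => if j = n then (b n : ℂ) * f (n - 1) else 0) (b j * f (j - 1)) := by
    convert hasSum_single (f := fun n => if j = n then (b n : ℂ) * f (n - 1) else 0) j
      (fun n hn => if_neg hn.symm) using 1
    simp
  have h₄ : HasSum (fun n => if j = n - 1 then (b n : ℂ) * f n else 0)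
      (b (j + 1) * f (j + 1)) := by
    convert hasSum_single (f := fun n => if j = n - 1 then (b n : ℂ) * f n else 0) (j + 1)
      (fun n hn => ?_) using 1
    · simp
    · rcases n with _ | n
      · simp [hb0]
      · rw [if_neg]; omega
  have h₅ := h₂.add (h₃.add h₄)
  refine h₁.unique ?_
  simpa only [jacobiTerm_apply] using h₅

theorem norm_sq_jacobiOp_single {a b : ℕ → ℝ} (ha : Summable fun n => |a n|)
    (hb : Summable fun n => |b n|) (hb0 : b 0 = 0) (k : ℕ) :
    ‖jacobiOp a b (lp.single 2 k 1)‖ ^ 2 = a k ^ 2 + (b k ^ 2 + b (k + 1) ^ 2) := by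
  set e : lp (fun _ : ℕ => ℂ) 2 := lp.single 2 k 1 with he
  have hval : ∀ j, e j = if j = k then 1 else 0 := fun j => by
    rw [he, lp.single_apply, Pi.single_apply]
  have hsym := (isSelfAdjoint_jacobiOp a b).isSymmetric e (jacobiOp a b e)
  have h : ((‖jacobiOp a b e‖ : ℂ)) ^ 2 = ((a k ^ 2 + (b k ^ 2 + b (k + 1) ^ 2) : ℝ) : ℂ) := by
    have h₁ := inner_self_eq_norm_sq_to_K (𝕜 := ℂ) (jacobiOp a b e)
    simp only [ContinuousLinearMap.coe_coe] at hsym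
    rw [h₁, he, lp.inner_single_left, ← he] at hsym
    simp only [Complex.coe_algebraMap] at hsym
    rw [hsym, jacobiOp_apply ha hb hb0]
    simp only [jacobiOp_apply ha hb hb0, hval]
    rcases k with _ | k
    · simp [hb0]; ring
    · have : k + 1 + 1 ≠ k := by omega
      simp [this]; ring
  exact_mod_cast h

theorem eq_zero_of_jacobiOp_eigenvector {a b : ℕ → ℝ} (ha : Summable fun n => |a n|)
    (hb : Summable fun n => |b n|) (hb0 : b 0 = 0) (hb' : ∀ n, b (n + 1) ≠ 0)
    {f : lp (fun _ : ℕ => ℂ) 2} {μ : ℂ} (hf : jacobiOp a b f = μ • f) (h0 : f 0 = 0) : f = 0 := by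
  have key : ∀ n, f n = 0 ∧ f (n + 1) = 0 := by
    intro n
    induction n with
    | zero =>
      refine ⟨h0, ?_⟩
      have := congrArg (fun g : lp (fun _ : ℕ => ℂ) 2 => g 0) hf
      simpa [jacobiOp_apply ha hb hb0, h0, hb0, hb' 0] using this
    | succ n ih =>
      refine ⟨ih.2, ?_⟩
      have := congrArg (fun g : lp (fun _ : ℕ => ℂ) 2 => g (n + 1)) hf
      simpa [jacobiOp_apply ha hb hb0, ih.1, ih.2, hb' (n + 1)] using this
  ext n
  simpa using (key n).1

theorem finrank_eigenspace_jacobiOp {a b : ℕ → ℝ} (ha : Summable fun n => |a n|)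
    (hb : Summable fun n => |b n|) (hb0 : b 0 = 0) (hb' : ∀ n, b (n + 1) ≠ 0) {μ : ℂ}
    (hμ : Module.End.HasEigenvalue
      (jacobiOp a b : lp (fun _ : ℕ => ℂ) 2 →ₗ[ℂ] lp (fun _ : ℕ => ℂ) 2) μ) :
    Module.finrank ℂ (Module.End.eigenspace
      (jacobiOp a b : lp (fun _ : ℕ => ℂ) 2 →ₗ[ℂ] lp (fun _ : ℕ => ℂ) 2) μ) = 1 := by
  obtain ⟨v, hv, hv0⟩ := hμ.exists_hasEigenvector
  have hv' := Module.End.mem_eigenspace_iff.1 hv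
  have hne : v 0 ≠ 0 := fun h => hv0 (eq_zero_of_jacobiOp_eigenvector ha hb hb0 hb' hv' h)
  refine finrank_eq_one_iff'.2 ⟨⟨v, hv⟩, fun h => hv0 (congrArg Subtype.val h), ?_⟩
  rintro ⟨w, hw⟩
  refine ⟨w 0 / v 0, Subtype.ext (sub_eq_zero.1 ?_)⟩
  have hmem := Submodule.sub_mem _ (Submodule.smul_mem _ (w 0 / v 0) hv) hw
  refine eq_zero_of_jacobiOp_eigenvector ha hb hb0 hb' (Module.End.mem_eigenspace_iff.1 hmem) ?_
  change (w 0 / v 0) * v 0 - w 0 = 0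
  rw [div_mul_cancel₀ _ hne, sub_self]

end Jacobi

section HilbertSchmidt

/-- For a self-adjoint operator, the sum of the squares of finitely many distinct eigenvalues is
bounded by the squared Hilbert–Schmidt norm. -/
theorem sum_sq_eigenvalues_le {T : lp (fun _ : ℕ => ℂ) 2 →L[ℂ] lp (fun _ : ℕ => ℂ) 2}
    (hT : IsSelfAdjoint T) (hs : Summable fun k : ℕ => ‖T (lp.single 2 k 1)‖ ^ 2) (F : Finset ℂ)
    (hF : ∀ μ ∈ F, Module.End.HasEigenvalue
      (T : lp (fun _ : ℕ => ℂ) 2 →ₗ[ℂ] lp (fun _ : ℕ => ℂ) 2) μ) :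
    ∑ μ ∈ F, ‖μ‖ ^ 2 ≤ ∑' k : ℕ, ‖T (lp.single 2 k 1)‖ ^ 2 := by
  have hex : ∀ μ : F, ∃ v : Module.End.eigenspace
      (T : lp (fun _ : ℕ => ℂ) 2 →ₗ[ℂ] lp (fun _ : ℕ => ℂ) 2) (μ : ℂ), ‖v‖ = 1 := by
    intro μ
    obtain ⟨v, hv, hv0⟩ := (hF μ μ.2).exists_hasEigenvector
    refine ⟨((‖v‖⁻¹ : ℝ) : ℂ) • ⟨v, hv⟩, ?_⟩
    have : ‖v‖ ≠ 0 := norm_ne_zero_iff.2 hv0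
    rw [norm_smul]
    simp [this]
  choose v hv using hex
  have hon : Orthonormal ℂ fun μ : F => (v μ : lp (fun _ : ℕ => ℂ) 2) := by
    refine ⟨fun μ => hv μ, fun μ ν h => ?_⟩
    exact hT.isSymmetric.orthogonalFamily_eigenspaces (fun h' => h (Subtype.ext h')) _ _
  have heig : ∀ μ : F, T (v μ) = (μ : ℂ) • (v μ : lp (fun _ : ℕ => ℂ) 2) := fun μ =>
    Module.End.mem_eigenspace_iff.1 (v μ).2
  have hpars : ∀ μ : F, HasSum (fun k => ‖inner ℂ (v μ : lp (fun _ : ℕ => ℂ) 2)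
      (T (lp.single 2 k 1))‖ ^ 2) (‖(μ : ℂ)‖ ^ 2) := by
    intro μ
    have h₁ := lp.hasSum_norm (p := 2) (by norm_num) ((μ : ℂ) • (v μ : lp (fun _ : ℕ => ℂ) 2))
    have h₂ : ‖(μ : ℂ) • (v μ : lp (fun _ : ℕ => ℂ) 2)‖ = ‖(μ : ℂ)‖ := by
      rw [norm_smul]
      exact (congrArg _ (hv μ)).trans (mul_one _)
    rw [h₂] at h₁
    have h₃ : ∀ k, ‖inner ℂ (v μ : lp (fun _ : ℕ => ℂ) 2) (T (lp.single 2 k 1))‖ =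
        ‖((μ : ℂ) • (v μ : lp (fun _ : ℕ => ℂ) 2)) k‖ := by
      intro k
      have := hT.isSymmetric (v μ : lp (fun _ : ℕ => ℂ) 2) (lp.single 2 k 1)
      simp only [ContinuousLinearMap.coe_coe] at this
      rw [← this, heig, lp.inner_single_right]
      simp
    simp only [h₃]
    simpa using h₁
  have h₁ : HasSum (fun k => ∑ μ : F, ‖inner ℂ (v μ : lp (fun _ : ℕ => ℂ) 2)
      (T (lp.single 2 k 1))‖ ^ 2) (∑ μ : F, ‖(μ : ℂ)‖ ^ 2) := hasSum_sum fun μ _ => hpars μ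
  rw [← Finset.sum_coe_sort]
  exact hasSum_le (fun k => hon.sum_inner_products_le _) h₁ hs.hasSum

end HilbertSchmidt

section Triangular

/-- A linear map that is upper triangular on the sequence `w` with pairwise distinct diagonal
entries has, for each `k`, an eigenvector of the form `w k + (combination of w j, j < k)`. -/
theorem exists_eigenvector_of_triangular {K V : Type*} [Field K] [AddCommGroup V] [Module K V]
    (D : V →ₗ[K] V) (w : ℕ → V) (l : ℕ → K) (hl : Function.Injective l)
    (hD : ∀ n, D (w n) - l n • w n ∈ Submodule.span K (w '' Set.Iio n)) (k : ℕ) :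
    ∃ u ∈ Submodule.span K (w '' Set.Iio k), D (w k + u) = l k • (w k + u) := by
  have key : ∀ n ≤ k, ∀ u ∈ Submodule.span K (w '' Set.Iio n),
      ∃ v ∈ Submodule.span K (w '' Set.Iio n), D v - l k • v = u := by
    intro n
    induction n with
    | zero =>
      intro _ u hu
      have : u = 0 := by simpa using hu
      exact ⟨0, Submodule.zero_mem _, by simp [this]⟩
    | succ n ih =>
      intro hn u hu
      have hset : w '' Set.Iio (n + 1) = insert (w n) (w '' Set.Iio n) := by
        rw [← Set.image_insert_eq]
        congr 1
        ext j
        simp only [Set.mem_insert_iff, Set.mem_Iio]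
        omega
      have hle : Submodule.span K (w '' Set.Iio n) ≤ Submodule.span K (w '' Set.Iio (n + 1)) :=
        Submodule.span_mono (by rw [hset]; exact Set.subset_insert _ _)
      have hwn : w n ∈ Submodule.span K (w '' Set.Iio (n + 1)) :=
        Submodule.subset_span (by rw [hset]; exact Set.mem_insert _ _)
      rw [hset] at hu
      obtain ⟨α, u', hu', rfl⟩ := Submodule.mem_span_insert.1 hu
      have hne : l n - l k ≠ 0 := sub_ne_zero.2 fun h => absurd (hl h) (by omega)
      obtain ⟨v', hv', hv⟩ := ih (by omega)
        (u' - (α / (l n - l k)) • (D (w n) - l n • w n))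
        (Submodule.sub_mem _ hu' (Submodule.smul_mem _ _ (hD n)))
      refine ⟨(α / (l n - l k)) • w n + v', Submodule.add_mem _ (Submodule.smul_mem _ _ hwn)
        (hle hv'), ?_⟩
      have h₁ : D ((α / (l n - l k)) • w n + v') - l k • ((α / (l n - l k)) • w n + v') =
          (α / (l n - l k)) • (D (w n) - l n • w n) +
            ((α / (l n - l k)) * (l n - l k)) • w n + (D v' - l k • v') := by
        rw [map_add, map_smul]
        module
      rw [h₁, hv, div_mul_cancel₀ _ hne]
      abel
  obtain ⟨u, hu, h⟩ := key k le_rfl (-(D (w k) - l k • w k)) (Submodule.neg_mem _ (hD k))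
  refine ⟨u, hu, ?_⟩
  rw [map_add, smul_add, ← sub_eq_zero]
  calc D (w k) + D u - (l k • w k + l k • u) = (D (w k) - l k • w k) + (D u - l k • u) := by abel
    _ = 0 := by rw [h]; abel

end Triangular

section Wall

/-- The diagonal of the Jacobi matrix of the Wall polynomials. -/
def wallDiag (p c : ℝ) (n : ℕ) : ℝ := (1 + c) * p ^ n - c * (1 + p) * p ^ (2 * n)

/-- The off-diagonal of the Jacobi matrix of the Wall polynomials: `wallOff p c n` couples the
coordinates `n - 1` and `n`. -/
def wallOff (p c : ℝ) (n : ℕ) : ℝ :=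
  √(c / p * p ^ (2 * n) * ((1 - p ^ n) * (1 - c * p ^ n)))

/-- The reversible weight of the birth-and-death chain attached to the Wall polynomials. -/
def wallWt (p c : ℝ) (n : ℕ) : ℝ :=
  c ^ n * p ^ (n ^ 2) /
    ((∏ j ∈ Finset.range n, (1 - p ^ (j + 1))) * ∏ j ∈ Finset.range n, (1 - c * p ^ (j + 1)))

variable {p c : ℝ}

theorem mul_pow_succ_lt_one (hp : 0 < p) (hp1 : p < 1) (hc : 0 < c) (hcp : c * p < 1) (n : ℕ) :
    c * p ^ (n + 1) < 1 := by
  have : p ^ n ≤ 1 := pow_le_one₀ hp.le hp1.le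
  calc c * p ^ (n + 1) = c * p * p ^ n := by ring
    _ ≤ c * p * 1 := by gcongr
    _ < 1 := by linarith

theorem one_sub_mul_pos (hp : 0 < p) (hp1 : p < 1) (hc : 0 < c) (hcp : c * p < 1) (n : ℕ) :
    0 < (1 - p ^ (n + 1)) * (1 - c * p ^ (n + 1)) :=
  mul_pos (sub_pos.2 (pow_lt_one₀ hp.le hp1 n.succ_ne_zero))
    (sub_pos.2 (mul_pow_succ_lt_one hp hp1 hc hcp n))

@[simp]
theorem wallOff_zero : wallOff p c 0 = 0 := by simp [wallOff]

theorem wallOff_sq (hp : 0 < p) (hp1 : p < 1) (hc : 0 < c) (hcp : c * p < 1) (n : ℕ) :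
    wallOff p c n ^ 2 = c / p * p ^ (2 * n) * ((1 - p ^ n) * (1 - c * p ^ n)) := by
  rcases n with _ | n
  · simp
  · have := one_sub_mul_pos hp hp1 hc hcp n
    exact Real.sq_sqrt (by positivity)

theorem wallOff_succ_pos (hp : 0 < p) (hp1 : p < 1) (hc : 0 < c) (hcp : c * p < 1) (n : ℕ) :
    0 < wallOff p c (n + 1) := by
  have := one_sub_mul_pos hp hp1 hc hcp n
  exact Real.sqrt_pos.2 (by positivity)

theorem summable_abs_wallDiag (hp : 0 < p) (hp1 : p < 1) :
    Summable fun n => |wallDiag p c n| := by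
  have h₁ := (summable_geometric_of_lt_one hp.le hp1).mul_left (1 + c)
  have h₂ := (summable_geometric_of_lt_one (sq_nonneg p) (by nlinarith)).mul_left (c * (1 + p))
  have := h₁.sub h₂
  simpa only [wallDiag, pow_mul] using this.abs

theorem summable_abs_wallOff (hp : 0 < p) (hp1 : p < 1) (hc : 0 < c) (hcp : c * p < 1) :
    Summable fun n => |wallOff p c n| := by
  refine Summable.of_nonneg_of_le (fun n => abs_nonneg _) (fun n => ?_)
    ((summable_geometric_of_lt_one hp.le hp1).mul_left √(c / p))
  rw [abs_of_nonneg (by exact Real.sqrt_nonneg _)]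
  rcases n with _ | n
  · simp
  · rw [wallOff, Real.sqrt_le_left (by positivity), mul_pow, Real.sq_sqrt (by positivity),
      ← pow_mul, mul_comm (n + 1) 2]
    refine mul_le_of_le_one_right (by positivity) (mul_le_one₀ ?_ ?_ ?_)
    · linarith [pow_pos hp (n + 1)]
    · linarith [mul_pow_succ_lt_one hp hp1 hc hcp n]
    · linarith [mul_pos hc (pow_pos hp (n + 1))]

theorem wallWt_pos (hp : 0 < p) (hp1 : p < 1) (hc : 0 < c) (hcp : c * p < 1) (n : ℕ) :
    0 < wallWt p c n := by
  refine div_pos (by positivity) (mul_pos ?_ ?_)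
  · exact Finset.prod_pos fun j _ => sub_pos.2 (pow_lt_one₀ hp.le hp1 j.succ_ne_zero)
  · exact Finset.prod_pos fun j _ => sub_pos.2 (mul_pow_succ_lt_one hp hp1 hc hcp j)

theorem wallWt_succ (n : ℕ) :
    wallWt p c (n + 1) =
      wallWt p c n * (c * p ^ (2 * n + 1)) / ((1 - p ^ (n + 1)) * (1 - c * p ^ (n + 1))) := by
  simp only [wallWt, Finset.prod_range_succ, div_mul_eq_mul_div, div_div]
  congr 1 <;> ring

theorem sqrt_mul_sqrt_eq_of_mul_eq {x y u v : ℝ} (hx : 0 ≤ x) (hy : 0 ≤ y)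
    (h : x * u = y ^ 2 * v) : √x * √u = y * √v := by
  rw [← Real.sqrt_mul hx, h, Real.sqrt_mul (sq_nonneg y), Real.sqrt_sq hy]

theorem wallOff_succ_mul_sqrt_succ (hp : 0 < p) (hp1 : p < 1) (hc : 0 < c) (hcp : c * p < 1)
    (n : ℕ) : wallOff p c (n + 1) * √(wallWt p c (n + 1)) =
      c * p ^ (2 * n + 1) * √(wallWt p c n) := by
  have h := one_sub_mul_pos hp hp1 hc hcp n
  refine sqrt_mul_sqrt_eq_of_mul_eq (by positivity) (by positivity) ?_
  rw [wallWt_succ]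
  generalize (1 - p ^ (n + 1)) * (1 - c * p ^ (n + 1)) = D at h
  field_simp
  ring

theorem wallOff_mul_sqrt_pred (hp : 0 < p) (hp1 : p < 1) (hc : 0 < c) (hcp : c * p < 1)
    (n : ℕ) : wallOff p c n * √(wallWt p c (n - 1)) =
      (1 - p ^ n) * (1 - c * p ^ n) * √(wallWt p c n) := by
  rcases n with _ | n
  · simp
  have h := one_sub_mul_pos hp hp1 hc hcp n
  refine sqrt_mul_sqrt_eq_of_mul_eq (by positivity) h.le ?_
  rw [wallWt_succ, Nat.add_sub_cancel]
  generalize (1 - p ^ (n + 1)) * (1 - c * p ^ (n + 1)) = D at h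
  field_simp
  ring

theorem summable_wallWt_mul_pow (hp : 0 < p) (hp1 : p < 1) (hc : 0 < c) (hcp : c * p < 1)
    (s : ℕ) : Summable fun n => wallWt p c n * (p⁻¹ ^ (n * s)) ^ 2 := by
  have hpos : ∀ n, 0 < wallWt p c n * (p⁻¹ ^ (n * s)) ^ 2 := fun n =>
    mul_pos (wallWt_pos hp hp1 hc hcp n) (by positivity)
  refine summable_of_ratio_test_tendsto_lt_one (l := 0) one_pos
    (Eventually.of_forall fun n => (hpos n).ne') ?_
  have hlim : Tendsto (fun n : ℕ => p ^ n) atTop (𝓝 0) :=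
    tendsto_pow_atTop_nhds_zero_of_lt_one hp.le hp1
  have h₁ : Tendsto (fun n : ℕ => c * p * (p ^ n) ^ 2 * (p⁻¹ ^ s) ^ 2 /
      ((1 - p * p ^ n) * (1 - c * p * p ^ n))) atTop
      (𝓝 (c * p * 0 ^ 2 * (p⁻¹ ^ s) ^ 2 / ((1 - p * 0) * (1 - c * p * 0)))) :=
    (((hlim.pow 2).const_mul _).mul_const _).div
      (((hlim.const_mul _).const_sub _).mul ((hlim.const_mul _).const_sub _)) (by simp)
  simp only [ne_eq, OfNat.ofNat_ne_zero, not_false_eq_true, zero_pow, mul_zero, zero_mul,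
    zero_div] at h₁
  refine h₁.congr fun n => ?_
  rw [Real.norm_of_nonneg (hpos _).le, Real.norm_of_nonneg (hpos _).le,
    wallWt_succ]
  have hw := (wallWt_pos hp hp1 hc hcp n).ne'
  have h := one_sub_mul_pos hp hp1 hc hcp n
  have e : (1 - p * p ^ n) * (1 - c * p * p ^ n) =
    (1 - p ^ (n + 1)) * (1 - c * p ^ (n + 1)) := by ring
  rw [e]
  generalize (1 - p ^ (n + 1)) * (1 - c * p ^ (n + 1)) = D at h
  rw [add_mul, one_mul, pow_add p⁻¹, inv_pow, inv_pow]
  field_simp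
  ring

theorem summable_wallWt (hp : 0 < p) (hp1 : p < 1) (hc : 0 < c) (hcp : c * p < 1) :
    Summable (wallWt p c) := by
  simpa using summable_wallWt_mul_pow hp hp1 hc hcp 0

theorem exists_lp_sqrt_wallWt_mul_pow (hp : 0 < p) (hp1 : p < 1) (hc : 0 < c)
    (hcp : c * p < 1) (s : ℕ) :
    ∃ w : lp (fun _ : ℕ => ℂ) 2, ∀ n, w n = ((√(wallWt p c n) * p⁻¹ ^ (n * s) : ℝ) : ℂ) := by
  refine ⟨⟨fun n => ((√(wallWt p c n) * p⁻¹ ^ (n * s) : ℝ) : ℂ), memℓp_gen ?_⟩, fun n => rfl⟩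
  refine (summable_wallWt_mul_pow hp hp1 hc hcp s).congr fun n => ?_
  rw [Complex.norm_real, Real.norm_eq_abs, ENNReal.toReal_ofNat, Real.rpow_two, sq_abs, mul_pow,
    Real.sq_sqrt (wallWt_pos hp hp1 hc hcp n).le]

theorem wall_recurrence (hp : 0 < p) (hp1 : p < 1) (hc : 0 < c) (hcp : c * p < 1) (s j : ℕ) :
    wallDiag p c j * (√(wallWt p c j) * p⁻¹ ^ (j * s)) +
      (wallOff p c j * (√(wallWt p c (j - 1)) * p⁻¹ ^ ((j - 1) * s)) +
        wallOff p c (j + 1) * (√(wallWt p c (j + 1)) * p⁻¹ ^ ((j + 1) * s))) =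
    p ^ s * (√(wallWt p c j) * p⁻¹ ^ (j * s)) +
      ((1 + c) * (1 - p ^ s) * (√(wallWt p c j) * p⁻¹ ^ (j * (s - 1))) +
        c * (p⁻¹ ^ s - 1) * (p - p ^ s) * (√(wallWt p c j) * p⁻¹ ^ (j * (s - 2)))) := by
  have h₁ : wallOff p c j * (√(wallWt p c (j - 1)) * p⁻¹ ^ ((j - 1) * s)) =
      (1 - p ^ j) * (1 - c * p ^ j) * √(wallWt p c j) * (p⁻¹ ^ (j * s) * p ^ s) := by
    rw [← wallOff_mul_sqrt_pred hp hp1 hc hcp]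
    rcases j with _ | j
    · simp
    · rw [Nat.add_sub_cancel, add_mul, one_mul, pow_add, mul_assoc (p⁻¹ ^ (j * s)), ← mul_pow,
        inv_mul_cancel₀ hp.ne', one_pow]
      ring
  rw [h₁, ← mul_assoc (wallOff p c (j + 1)), wallOff_succ_mul_sqrt_succ hp hp1 hc hcp, wallDiag,
    add_mul j 1 s, one_mul, pow_add p⁻¹, pow_mul _ j s, pow_mul _ j (s - 1), pow_mul _ j (s - 2),
    inv_pow _ j, pow_succ p (2 * j), mul_comm 2 j, pow_mul p j 2, inv_pow _ s]
  have hP : p ^ j ≠ 0 := pow_ne_zero _ hp.ne'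
  generalize p ^ j = P at hP
  generalize √(wallWt p c j) = r
  rcases s with _ | _ | s
  · simp; ring
  · simp only [zero_add, pow_one, pow_zero, show 1 - 2 = 0 from rfl]
    field_simp
    ring
  · simp only [show s + 1 + 1 - 1 = s + 1 from rfl,
      show s + 1 + 1 - 2 = s from rfl]
    simp only [inv_pow, pow_succ]
    field_simp
    ring

theorem wallOff_ne_zero (hp : 0 < p) (hp1 : p < 1) (hc : 0 < c) (hcp : c * p < 1) (n : ℕ) :
    wallOff p c (n + 1) ≠ 0 := (wallOff_succ_pos hp hp1 hc hcp n).ne'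

theorem hasSum_hilbertSchmidt_wall (hp : 0 < p) (hp1 : p < 1) (hc : 0 < c) (hcp : c * p < 1) :
    HasSum (fun k => wallDiag p c k ^ 2 + (wallOff p c k ^ 2 + wallOff p c (k + 1) ^ 2))
      (1 - p ^ 2)⁻¹ := by
  have g : ∀ i ≠ 0, HasSum (fun n => (p ^ i) ^ n) (1 - p ^ i)⁻¹ := fun i hi =>
    hasSum_geometric_of_lt_one (by positivity) (pow_lt_one₀ hp.le hp1 hi)
  have h := (((g 2 (by norm_num)).mul_left ((1 + c) ^ 2 + c / p + c * p)).sub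
    ((g 3 (by norm_num)).mul_left (2 * c * (1 + c) * (1 + p) + c / p * (1 + c) +
      c * p ^ 2 * (1 + c)))).add
    ((g 4 (by norm_num)).mul_left (c ^ 2 * (1 + p) ^ 2 + c / p * c + c ^ 2 * p ^ 3))
  have key : ∀ {f g : ℕ → ℝ} {x y : ℝ}, HasSum f x → (∀ n, g n = f n) → y = x → HasSum g y :=
    fun hf hg hx => by rwa [funext hg, hx]
  refine key h (fun n => ?_) ?_
  · rw [wallOff_sq hp hp1 hc hcp, wallOff_sq hp hp1 hc hcp, wallDiag]
    simp only [pow_right_comm p _ n, pow_succ p n, mul_comm 2, pow_mul]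
    generalize p ^ n = P
    field_simp
    ring
  · have h₁ : (1 - p) ≠ 0 := by linarith
    have h₂ : (1 + p) ≠ 0 := by linarith
    have h₃ : (1 + p + p ^ 2) ≠ 0 := by positivity
    have h₄ : (1 + p ^ 2) ≠ 0 := by positivity
    rw [show 1 - p ^ 2 = (1 - p) * (1 + p) by ring,
      show 1 - p ^ 3 = (1 - p) * (1 + p + p ^ 2) by ring,
      show 1 - p ^ 4 = (1 - p) * (1 + p) * (1 + p ^ 2) by ring]
    field_simp
    ring



theorem ofReal_pow_injective (hp : 0 < p) (hp1 : p < 1) :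
    Function.Injective fun s : ℕ => (p : ℂ) ^ s := by
  intro s t hst
  have h : p ^ s = p ^ t := by
    simp only [← Complex.ofReal_pow] at hst
    exact Complex.ofReal_injective hst
  exact pow_right_injective₀ hp hp1.ne h

theorem jacobiOp_wall_apply (hp : 0 < p) (hp1 : p < 1) (hc : 0 < c) (hcp : c * p < 1)
    (f : lp (fun _ : ℕ => ℂ) 2) (j : ℕ) :
    jacobiOp (wallDiag p c) (wallOff p c) f j =
      wallDiag p c j * f j + (wallOff p c j * f (j - 1) + wallOff p c (j + 1) * f (j + 1)) :=
  jacobiOp_apply (summable_abs_wallDiag hp hp1) (summable_abs_wallOff hp hp1 hc hcp)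
    wallOff_zero f j

/-- Sequences in the span of the weighted powers of degree `< k` are negligible with respect to the
weighted power of degree `k`. -/
theorem tendsto_div_of_mem_span_wall (hp : 0 < p) (hp1 : p < 1) (hc : 0 < c) (hcp : c * p < 1)
    {w : ℕ → lp (fun _ : ℕ => ℂ) 2}
    (hw : ∀ s n, w s n = ((√(wallWt p c n) * p⁻¹ ^ (n * s) : ℝ) : ℂ)) {k : ℕ}
    {u : lp (fun _ : ℕ => ℂ) 2} (hu : u ∈ Submodule.span ℂ (w '' Set.Iio k)) :
    Tendsto (fun n => u n / w k n) atTop (𝓝 0) := by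
  induction hu using Submodule.span_induction with
  | mem x hx =>
    obtain ⟨j, hj, rfl⟩ := hx
    obtain ⟨d, rfl⟩ := Nat.exists_eq_add_of_lt (Set.mem_Iio.1 hj)
    have hlim : Tendsto (fun n : ℕ => (((p ^ (d + 1)) ^ n : ℝ) : ℂ)) atTop (𝓝 ((0 : ℝ) : ℂ)) :=
      (Complex.continuous_ofReal.tendsto 0).comp (tendsto_pow_atTop_nhds_zero_of_lt_one
        (by positivity) (pow_lt_one₀ hp.le hp1 d.succ_ne_zero))
    rw [Complex.ofReal_zero] at hlim
    refine hlim.congr fun n => ?_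
    rw [hw, hw, ← Complex.ofReal_div]
    congr 1
    have hr : √(wallWt p c n) ≠ 0 := (Real.sqrt_pos.2 (wallWt_pos hp hp1 hc hcp n)).ne'
    rw [show n * (j + d + 1) = n * j + (d + 1) * n by ring, pow_add p⁻¹, pow_mul p⁻¹ (d + 1), inv_pow p (d + 1),
      inv_pow _ n]
    field_simp
  | zero => simp
  | add x y _ _ hx hy => simpa [add_div] using hx.add hy
  | smul a x _ hx => simpa [mul_div_assoc] using hx.const_mul a

theorem hasEigenvalue_jacobiOp_wall (hp : 0 < p) (hp1 : p < 1) (hc : 0 < c) (hcp : c * p < 1)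
    (k : ℕ) : Module.End.HasEigenvalue (jacobiOp (wallDiag p c) (wallOff p c) :
      lp (fun _ : ℕ => ℂ) 2 →ₗ[ℂ] lp (fun _ : ℕ => ℂ) 2) ((p : ℂ) ^ k) := by
  choose w hw using exists_lp_sqrt_wallWt_mul_pow hp hp1 hc hcp
  have hinj : Function.Injective fun s : ℕ => (p : ℂ) ^ s :=
    ofReal_pow_injective hp hp1
  have htri : ∀ s, (jacobiOp (wallDiag p c) (wallOff p c) :
      lp (fun _ : ℕ => ℂ) 2 →ₗ[ℂ] lp (fun _ : ℕ => ℂ) 2) (w s) - (p : ℂ) ^ s • w s =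
        (((1 + c) * (1 - p ^ s) : ℝ) : ℂ) • w (s - 1) +
          ((c * (p⁻¹ ^ s - 1) * (p - p ^ s) : ℝ) : ℂ) • w (s - 2) := by
    intro s
    rw [sub_eq_iff_eq_add']
    ext j
    simp only [ContinuousLinearMap.coe_coe, jacobiOp_wall_apply hp hp1 hc hcp, lp.coeFn_add,
      lp.coeFn_smul, Pi.add_apply, Pi.smul_apply, smul_eq_mul, hw]
    exact_mod_cast wall_recurrence hp hp1 hc hcp s j
  obtain ⟨u, hu, h⟩ := exists_eigenvector_of_triangular
    (jacobiOp (wallDiag p c) (wallOff p c) :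
      lp (fun _ : ℕ => ℂ) 2 →ₗ[ℂ] lp (fun _ : ℕ => ℂ) 2) w _ hinj (fun s => by
    rw [htri]
    have hmem : ∀ i < s, w i ∈ Submodule.span ℂ (w '' Set.Iio s) := fun i hi =>
      Submodule.subset_span ⟨i, hi, rfl⟩
    rcases s with _ | _ | s
    · simp
    · have := hmem 0 one_pos
      simpa using Submodule.smul_mem _ _ this
    · exact Submodule.add_mem _ (Submodule.smul_mem _ _ (hmem _ (by omega)))
        (Submodule.smul_mem _ _ (hmem _ (by omega)))) k
  refine Module.End.hasEigenvalue_of_hasEigenvector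
    ⟨Module.End.mem_eigenspace_iff.2 h, fun h0 => ?_⟩
  have hlim := tendsto_div_of_mem_span_wall hp hp1 hc hcp hw hu
  have hconst : ∀ n, u n / w k n = -1 := by
    intro n
    have hne : w k n ≠ 0 := by
      rw [hw, Complex.ofReal_ne_zero]
      exact (mul_pos (Real.sqrt_pos.2 (wallWt_pos hp hp1 hc hcp n)) (by positivity)).ne'
    have h0n : w k n + u n = 0 := congrArg (fun g : lp (fun _ : ℕ => ℂ) 2 => g n) h0
    rw [div_eq_iff hne]
    linear_combination h0n
  simp only [hconst] at hlim
  have := tendsto_nhds_unique hlim tendsto_const_nhds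
  norm_num at this

theorem eq_zero_of_jacobiOp_wall_eq_zero (hp : 0 < p) (hp1 : p < 1) (hc : 0 < c)
    (hcp : c * p < 1) {f : lp (fun _ : ℕ => ℂ) 2}
    (hf : jacobiOp (wallDiag p c) (wallOff p c) f = 0) : f = 0 := by
  have hrec : ∀ j, wallDiag p c j * f j +
      (wallOff p c j * f (j - 1) + wallOff p c (j + 1) * f (j + 1)) = 0 := by
    intro j
    rw [← jacobiOp_wall_apply hp hp1 hc hcp, hf]
    rfl
  have hstep : ∀ j, (wallOff p c (j + 1) : ℂ) * f (j + 1) =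
      -((p ^ j * (1 - c * p ^ (j + 1)) : ℝ) : ℂ) * f j := by
    intro j
    induction j with
    | zero =>
      have h := hrec 0
      simp only [wallOff_zero, wallDiag] at h
      push_cast at h ⊢
      linear_combination h
    | succ j ih =>
      have h := hrec (j + 1)
      rw [Nat.add_sub_cancel] at h
      have hne : (p ^ j * (1 - c * p ^ (j + 1)) : ℝ) ≠ 0 :=
        (mul_pos (pow_pos hp j) (sub_pos.2 (mul_pow_succ_lt_one hp hp1 hc hcp j))).ne'
      have hsq : (wallOff p c (j + 1) : ℂ) ^ 2 = ((p ^ j * (1 - c * p ^ (j + 1)) *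
          (c * p ^ (j + 1) * (1 - p ^ (j + 1))) : ℝ) : ℂ) := by
        have := wallOff_sq hp hp1 hc hcp (j + 1)
        rw [← Complex.ofReal_pow, this]
        congr 1
        field_simp
        ring
      have hprev : (wallOff p c (j + 1) : ℂ) * f j =
          -((c * p ^ (j + 1) * (1 - p ^ (j + 1)) : ℝ) : ℂ) * f (j + 1) := by
        refine mul_left_cancel₀ (Complex.ofReal_ne_zero.2 hne) ?_
        rw [Complex.ofReal_mul (p ^ j * (1 - c * p ^ (j + 1)))] at hsq
        linear_combination (wallOff p c (j + 1) : ℂ) * ih - f (j + 1) * hsq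
      rw [hprev] at h
      simp only [wallDiag] at h
      push_cast at h ⊢
      linear_combination h
  have hsq : ∀ j, c * p * ((1 - p ^ (j + 1)) * ‖f (j + 1)‖ ^ 2) =
      (1 - c * p ^ (j + 1)) * ‖f j‖ ^ 2 := by
    intro j
    have h := congrArg (fun z : ℂ => ‖z‖ ^ 2) (hstep j)
    simp only [norm_mul, norm_neg, Complex.norm_real, mul_pow, Real.norm_eq_abs, sq_abs,
      wallOff_sq hp hp1 hc hcp] at h
    have h₁ := (sub_pos.2 (mul_pow_succ_lt_one hp hp1 hc hcp j)).ne'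
    refine mul_left_cancel₀ (mul_ne_zero (pow_ne_zero 2 (pow_ne_zero j hp.ne')) h₁) ?_
    rw [show c / p * p ^ (2 * (j + 1)) = c * p * (p ^ j) ^ 2 by field_simp; ring] at h
    linear_combination h
  have hmono : Monotone fun j => (1 - p ^ j) * ‖f j‖ ^ 2 := by
    refine monotone_nat_of_le_succ fun j => ?_
    have hpj : p ^ (j + 1) < 1 := pow_lt_one₀ hp.le hp1 j.succ_ne_zero
    have hcj : c * p ^ (j + 1) ≤ p ^ j := by
      rw [pow_succ']
      nlinarith [pow_pos hp j]
    have hX : 0 ≤ (1 - p ^ (j + 1)) * ‖f (j + 1)‖ ^ 2 :=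
      mul_nonneg (by linarith) (sq_nonneg _)
    calc (1 - p ^ j) * ‖f j‖ ^ 2 ≤ (1 - c * p ^ (j + 1)) * ‖f j‖ ^ 2 := by gcongr
      _ = c * p * ((1 - p ^ (j + 1)) * ‖f (j + 1)‖ ^ 2) := (hsq j).symm
      _ ≤ (1 - p ^ (j + 1)) * ‖f (j + 1)‖ ^ 2 := mul_le_of_le_one_left hX hcp.le
  have hlim : Tendsto (fun j => ‖f j‖ ^ 2) atTop (𝓝 0) := by
    have := (lp.hasSum_norm (p := 2) (by norm_num) f).summable.tendsto_atTop_zero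
    simpa using this
  have hzero : Tendsto (fun j => (1 - p ^ j) * ‖f j‖ ^ 2) atTop (𝓝 ((1 - 0) * 0)) :=
    ((tendsto_pow_atTop_nhds_zero_of_lt_one hp.le hp1).const_sub 1).mul hlim
  rw [mul_zero] at hzero
  have h1 : (1 - p ^ 1) * ‖f 1‖ ^ 2 ≤ 0 := hmono.ge_of_tendsto hzero 1
  have hf1 : ‖f 1‖ ^ 2 = 0 := by
    rw [pow_one] at h1
    nlinarith [sq_nonneg ‖f 1‖]
  have hf0 : ‖f 0‖ ^ 2 = 0 := by
    have := hsq 0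
    simp only [zero_add, pow_one, hf1, mul_zero] at this
    exact (mul_eq_zero.1 this.symm).resolve_left (by linarith)
  refine eq_zero_of_jacobiOp_eigenvector (μ := 0) (summable_abs_wallDiag hp hp1)
    (summable_abs_wallOff hp hp1 hc hcp) wallOff_zero (wallOff_ne_zero hp hp1 hc hcp)
    (by rw [hf, zero_smul]) (by simpa using hf0)

theorem hasSum_norm_sq_jacobiOp_wall (hp : 0 < p) (hp1 : p < 1) (hc : 0 < c) (hcp : c * p < 1) :
    HasSum (fun k : ℕ => ‖jacobiOp (wallDiag p c) (wallOff p c) (lp.single 2 k 1)‖ ^ 2)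
      (1 - p ^ 2)⁻¹ := by
  simp only [norm_sq_jacobiOp_single (summable_abs_wallDiag hp hp1)
    (summable_abs_wallOff hp hp1 hc hcp) wallOff_zero]
  exact hasSum_hilbertSchmidt_wall hp hp1 hc hcp

theorem hasEigenvalue_jacobiOp_wall_iff (hp : 0 < p) (hp1 : p < 1) (hc : 0 < c)
    (hcp : c * p < 1) (μ : ℂ) :
    Module.End.HasEigenvalue (jacobiOp (wallDiag p c) (wallOff p c) :
      lp (fun _ : ℕ => ℂ) 2 →ₗ[ℂ] lp (fun _ : ℕ => ℂ) 2) μ ↔ ∃ k : ℕ, μ = (p : ℂ) ^ k := by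
  refine ⟨fun hμ => ?_, ?_⟩
  · by_contra! hne
    have hHS := hasSum_norm_sq_jacobiOp_wall hp hp1 hc hcp
    have hinj : Function.Injective fun s : ℕ => (p : ℂ) ^ s :=
      ofReal_pow_injective hp hp1
    have hle : ∀ N, ‖μ‖ ^ 2 + ∑ k ∈ Finset.range N, (p ^ 2) ^ k ≤ (1 - p ^ 2)⁻¹ := by
      intro N
      have h := sum_sq_eigenvalues_le (isSelfAdjoint_jacobiOp (wallDiag p c) (wallOff p c))
        hHS.summable (insert μ ((Finset.range N).image fun k => (p : ℂ) ^ k)) (by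
          intro ν hν
          rcases Finset.mem_insert.1 hν with rfl | hν
          · exact hμ
          · obtain ⟨k, -, rfl⟩ := Finset.mem_image.1 hν
            exact hasEigenvalue_jacobiOp_wall hp hp1 hc hcp k)
      rw [hHS.tsum_eq, Finset.sum_insert (by simpa using fun k _ => (hne k).symm),
        Finset.sum_image hinj.injOn] at h
      simpa [pow_right_comm, abs_of_pos hp] using h
    have hlim := (hasSum_geometric_of_lt_one (sq_nonneg p)
      (pow_lt_one₀ hp.le hp1 two_ne_zero)).tendsto_sum_nat.const_add (‖μ‖ ^ 2)
    have hμ0 : μ = 0 := by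
      have := le_of_tendsto' hlim hle
      have : ‖μ‖ ^ 2 = 0 := le_antisymm (by linarith) (sq_nonneg _)
      simpa using this
    obtain ⟨v, hv, hv0⟩ := hμ.exists_hasEigenvector
    have hv' := Module.End.mem_eigenspace_iff.1 hv
    rw [hμ0, zero_smul] at hv'
    exact hv0 (eq_zero_of_jacobiOp_wall_eq_zero hp hp1 hc hcp hv')
  · rintro ⟨k, rfl⟩
    exact hasEigenvalue_jacobiOp_wall hp hp1 hc hcp k

end Wall

section Conversion

variable {q m : ℝ}

theorem rpow_neg_mul_inv_pow (hq : 1 < q) (x : ℝ) (n : ℕ) :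
    q ^ (-x) * q⁻¹ ^ n = q ^ (-x - n) := by
  rw [Real.rpow_sub (by linarith), Real.rpow_natCast, inv_pow, div_eq_mul_inv]

theorem rpow_neg_mul_inv_lt_one (hq : 1 < q) (hm : -1 < m) : q ^ (-m) * q⁻¹ < 1 := by
  have h := rpow_neg_mul_inv_pow hq m 1
  rw [pow_one] at h
  rw [h]
  exact Real.rpow_lt_one_of_one_lt_of_neg hq (by push_cast; linarith)

theorem rpow_neg_natCast_eq (hq : 1 < q) (n : ℕ) : q ^ (-(n : ℝ)) = q⁻¹ ^ n := by
  rw [Real.rpow_neg (by linarith), Real.rpow_natCast, inv_pow]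

theorem rpow_up_eq (hq : 1 < q) (i : ℕ) :
    q ^ (-1 - 2 * (i : ℝ) - m) = q ^ (-m) * q⁻¹ ^ (2 * i + 1) := by
  rw [rpow_neg_mul_inv_pow hq]
  congr 1
  push_cast
  ring

theorem piWt_eq (hq : 1 < q) (n : ℕ) : piWt q m n = wallWt q⁻¹ (q ^ (-m)) n := by
  have hq0 : 0 < q := by linarith
  rw [piWt, wallWt]
  congr 1
  · rw [← Real.rpow_natCast (q ^ (-m)), ← Real.rpow_mul hq0.le, ← neg_neg (-m * (n : ℝ)),
      rpow_neg_mul_inv_pow hq]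
    congr 1
    push_cast
    ring
  · congr 1
    · refine Finset.prod_congr rfl fun j _ => ?_
      rw [← rpow_neg_natCast_eq hq, Nat.cast_succ]
    · refine Finset.prod_congr rfl fun j _ => ?_
      rw [rpow_neg_mul_inv_pow hq, Nat.cast_succ]

theorem Pm_succ (hq : 1 < q) (i : ℕ) : Pm q m i (i + 1) = q ^ (-m) * q⁻¹ ^ (2 * i + 1) := by
  rw [Pm, if_pos rfl, rpow_up_eq hq]

theorem Pm_pred (hq : 1 < q) (i : ℕ) :
    Pm q m (i + 1) i = (1 - q⁻¹ ^ (i + 1)) * (1 - q ^ (-m) * q⁻¹ ^ (i + 1)) := by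
  rw [Pm, if_neg (by omega), if_neg (by omega), if_pos rfl, rpow_neg_natCast_eq hq,
    rpow_neg_mul_inv_pow hq]

theorem Pm_self (hq : 1 < q) (i : ℕ) : Pm q m i i = wallDiag q⁻¹ (q ^ (-m)) i := by
  rw [Pm, if_neg (by omega), if_pos rfl, rpow_neg_natCast_eq hq, ← rpow_neg_mul_inv_pow hq,
    rpow_up_eq hq, wallDiag]
  ring

theorem Pm_eq_zero {i j : ℕ} (h₁ : j ≠ i + 1) (h₂ : j ≠ i) (h₃ : i ≠ j + 1) :
    Pm q m i j = 0 := by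
  rw [Pm, if_neg h₁, if_neg h₂, if_neg h₃]

theorem piM_div_piM (hq : 1 < q) (hm : -1 < m) (i j : ℕ) :
    piM q m i / piM q m j = wallWt q⁻¹ (q ^ (-m)) i / wallWt q⁻¹ (q ^ (-m)) j := by
  have hp : 0 < q⁻¹ := inv_pos.2 (by linarith)
  have hp1 : q⁻¹ < 1 := inv_lt_one_of_one_lt₀ hq
  have hc : 0 < q ^ (-m) := Real.rpow_pos_of_pos (by linarith) _
  have hcp := rpow_neg_mul_inv_lt_one hq hm
  have hZ : 0 < ∑' k, piWt q m k := by
    simp only [piWt_eq hq]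
    exact (summable_wallWt hp hp1 hc hcp).tsum_pos
      (fun n => (wallWt_pos hp hp1 hc hcp n).le) 0 (wallWt_pos hp hp1 hc hcp 0)
  rw [piM, piM, mul_div_mul_left _ _ (inv_ne_zero hZ.ne'), piWt_eq hq, piWt_eq hq]

theorem Pm_mul_sqrt_self (hq : 1 < q) (hm : -1 < m) (i : ℕ) :
    Pm q m i i * √(piM q m i / piM q m i) = wallDiag q⁻¹ (q ^ (-m)) i := by
  have hw := wallWt_pos (inv_pos.2 (by linarith)) (inv_lt_one_of_one_lt₀ hq)
    (Real.rpow_pos_of_pos (by linarith) _) (rpow_neg_mul_inv_lt_one hq hm) i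
  rw [piM_div_piM hq hm, div_self hw.ne', Real.sqrt_one, mul_one, Pm_self hq]

theorem Pm_mul_sqrt_succ (hq : 1 < q) (hm : -1 < m) (i : ℕ) :
    Pm q m i (i + 1) * √(piM q m i / piM q m (i + 1)) = wallOff q⁻¹ (q ^ (-m)) (i + 1) := by
  have hp : 0 < q⁻¹ := inv_pos.2 (by linarith)
  have hp1 : q⁻¹ < 1 := inv_lt_one_of_one_lt₀ hq
  have hc : 0 < q ^ (-m) := Real.rpow_pos_of_pos (by linarith) _
  have hcp := rpow_neg_mul_inv_lt_one hq hm
  rw [piM_div_piM hq hm, Pm_succ hq, Real.sqrt_div (wallWt_pos hp hp1 hc hcp i).le,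
    ← mul_div_assoc, div_eq_iff (Real.sqrt_pos.2 (wallWt_pos hp hp1 hc hcp (i + 1))).ne',
    wallOff_succ_mul_sqrt_succ hp hp1 hc hcp]

theorem Pm_mul_sqrt_pred (hq : 1 < q) (hm : -1 < m) (i : ℕ) :
    Pm q m (i + 1) i * √(piM q m (i + 1) / piM q m i) = wallOff q⁻¹ (q ^ (-m)) (i + 1) := by
  have hp : 0 < q⁻¹ := inv_pos.2 (by linarith)
  have hp1 : q⁻¹ < 1 := inv_lt_one_of_one_lt₀ hq
  have hc : 0 < q ^ (-m) := Real.rpow_pos_of_pos (by linarith) _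
  have hcp := rpow_neg_mul_inv_lt_one hq hm
  rw [piM_div_piM hq hm, Pm_pred hq, Real.sqrt_div (wallWt_pos hp hp1 hc hcp (i + 1)).le,
    ← mul_div_assoc, div_eq_iff (Real.sqrt_pos.2 (wallWt_pos hp hp1 hc hcp i)).ne',
    ← wallOff_mul_sqrt_pred hp hp1 hc hcp, Nat.add_sub_cancel]

theorem jacobiOp_wall_eq_tsum (hq : 1 < q) (hm : -1 < m) (f : lp (fun _ : ℕ => ℂ) 2) (j : ℕ) :
    jacobiOp (wallDiag q⁻¹ (q ^ (-m))) (wallOff q⁻¹ (q ^ (-m))) f j =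
      ∑' i : ℕ, f i * ((Pm q m i j * √(piM q m i / piM q m j) : ℝ) : ℂ) := by
  rw [jacobiOp_wall_apply (inv_pos.2 (by linarith)) (inv_lt_one_of_one_lt₀ hq)
    (Real.rpow_pos_of_pos (by linarith) _) (rpow_neg_mul_inv_lt_one hq hm)]
  rcases j with _ | j
  · rw [tsum_eq_sum (s := {0, 1}) fun i hi => ?_]
    · rw [Finset.sum_pair zero_ne_one, Pm_mul_sqrt_self hq hm,
        show Pm q m 1 0 * √(piM q m 1 / piM q m 0) = _ from Pm_mul_sqrt_pred hq hm 0, wallOff_zero]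
      push_cast
      ring
    · simp only [Finset.mem_insert, Finset.mem_singleton, not_or] at hi
      rw [Pm_eq_zero (by omega) (by omega) (by omega)]
      simp
  · rw [tsum_eq_sum (s := {j, j + 1, j + 1 + 1}) fun i hi => ?_]
    · rw [Finset.sum_insert (by simp; omega), Finset.sum_pair (by omega), Pm_mul_sqrt_succ hq hm,
        Pm_mul_sqrt_self hq hm, Pm_mul_sqrt_pred hq hm, Nat.add_sub_cancel]
      ring
    · simp only [Finset.mem_insert, Finset.mem_singleton, not_or] at hi
      rw [Pm_eq_zero (by omega) (by omega) (by omega)]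
      simp

end Conversion

/-- The operator `μ ↦ μP_m` on `ℓ²(π_m)` (realized on standard `ℓ²(ℕ,ℂ)` via
the isometry `μ ↦ (μ(i)/√π_m(i))`, i.e. as the kernel operator with symmetric kernel
`P_m(i,j)·√(π_m(i)/π_m(j))`) is Hilbert–Schmidt (in particular compact) and self-adjoint; its
eigenvalues are exactly `{q^{-k} : k ≥ 0}` and every eigenspace is one-dimensional. -/
theorem stmt4 (q m : ℝ) (hq : 1 < q) (hm : -1 < m) :
    ∃ T : lp (fun _ : ℕ => ℂ) 2 →L[ℂ] lp (fun _ : ℕ => ℂ) 2,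
      (∀ (f : lp (fun _ : ℕ => ℂ) 2) (j : ℕ),
        T f j = ∑' i : ℕ, f i * ((Pm q m i j * Real.sqrt (piM q m i / piM q m j) : ℝ) : ℂ)) ∧
      Summable (fun k : ℕ => ‖T (lp.single 2 k 1)‖ ^ 2) ∧
      IsCompactOperator T ∧
      IsSelfAdjoint T ∧
      (∀ μ : ℂ,
        Module.End.HasEigenvalue
            (T : lp (fun _ : ℕ => ℂ) 2 →ₗ[ℂ] lp (fun _ : ℕ => ℂ) 2) μ
          ↔ ∃ k : ℕ, μ = ((q : ℂ))⁻¹ ^ k) ∧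
      (∀ k : ℕ, Module.finrank ℂ
          (Module.End.eigenspace
            (T : lp (fun _ : ℕ => ℂ) 2 →ₗ[ℂ] lp (fun _ : ℕ => ℂ) 2) (((q : ℂ))⁻¹ ^ k)) = 1) := by
  have hp : 0 < q⁻¹ := inv_pos.2 (by linarith)
  have hp1 : q⁻¹ < 1 := inv_lt_one_of_one_lt₀ hq
  have hc : 0 < q ^ (-m) := Real.rpow_pos_of_pos (by linarith) _
  have hcp := rpow_neg_mul_inv_lt_one hq hm
  rw [← Complex.ofReal_inv]
  exact ⟨jacobiOp (wallDiag q⁻¹ (q ^ (-m))) (wallOff q⁻¹ (q ^ (-m))),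
    jacobiOp_wall_eq_tsum hq hm,
    (hasSum_norm_sq_jacobiOp_wall hp hp1 hc hcp).summable,
    isCompactOperator_jacobiOp (summable_abs_wallDiag hp hp1)
      (summable_abs_wallOff hp hp1 hc hcp),
    isSelfAdjoint_jacobiOp _ _,
    hasEigenvalue_jacobiOp_wall_iff hp hp1 hc hcp,
    fun k => finrank_eigenspace_jacobiOp (summable_abs_wallDiag hp hp1)
      (summable_abs_wallOff hp hp1 hc hcp) wallOff_zero (wallOff_ne_zero hp hp1 hc hcp)
      (hasEigenvalue_jacobiOp_wall hp hp1 hc hcp k)⟩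
end
end
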